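/- Let d = r + p + t with r, p, t ≥ 0 and let f : (ℂ^d, 0) → (ℂ^d, 0) be a contracting holomorphic germ which, in coordinates (u, y, w) ∈ ℂ^r × ℂ^p × ℂ^t, has the form f(u, y, w) = (α u (1 + θ(u,y,w)), β u^C y^D (1 + g₀(u,y,w)), k(u,y,w)), where: α ∈ (ℂ*)^r, β ∈ (ℂ*)^p; C ∈ M_{r×p}(ℕ) and D ∈ M_{p×p}(ℕ) with det D ≠ 0 and with ∑_l C_{l,j} + ∑_l D_{l,j} ≥ 2 for every column j = 1,…,p; θ, g₀, k are holomorphic germs vanishing at 0 (with values in ℂ^r, ℂ^p, ℂ^t respectively); and the differential df₀ is diagonalizable (its nilpotent part vanishes). Let s be the number of nonzero eigenvalues of df₀ counted with algebraic multiplicity (equivalently, the rank of (df₀)^d) and let λ = (λ₁,…,λ_s) list these eigenvalues. Then f is holomorphically conjugated to a germ of the form (x, y, z) ↦ (σ(x), β' x^E y^D (1 + g(x)), h(x,y,z)), with x ∈ ℂ^s, y ∈ ℂ^p, z ∈ ℂ^{d−(s+p)}, where: β' ∈ (ℂ*)^p; E ∈ M_{s×p}(ℕ); σ : (ℂ^s,0)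 → (ℂ^s,0) is an invertible polynomial map in Poincaré–Dulac normal form, i.e. σ_k(x) = λ_k x_k + ∑_n c_{k,n} x^n where c_{k,n} ≠ 0 only if |n| ≥ 2 and λ^n = λ_k; g : (ℂ^s,0) → (ℂ^p,0) is a polynomial map containing only secondary resonant monomials, i.e. every monomial x^n appearing with nonzero coefficient in some component of g satisfies that λ^n is an eigenvalue of D regarded as a complex p×p matrix; and h : (ℂ^d,0) → (ℂ^{d−(s+p)},0) is a holomorphic germ with dh₀ = 0. -/

import Mathlib

open Polynomial

noncomputable section

/-- `ℂ^a × ℂ^b × ℂ^c`. -/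
abbrev Sp (a b c : ℕ) : Type := (Fin a → ℂ) × (Fin b → ℂ) × (Fin c → ℂ)

section Aux
open Filter Topology Asymptotics

/-- majorant-type class of convergent (word) power series -/
def Maj {ι V : Type} [Fintype ι] [NormedAddCommGroup V] [NormedSpace ℂ V]
    (N : ℕ) (R K : ℝ) (F : (ι → ℂ) → V) : Prop :=
  ∃ (J : Type) (w : J → List ι) (a : J → V), (∀ j, N ≤ (w j).length) ∧
    (∃ K', K' ≤ K ∧ HasSum (fun j => ‖a j‖ * R ^ (w j).length) K') ∧
    ∀ x : ι → ℂ, ‖x‖ ≤ R → HasSum (fun j => ((w j).map x).prod • a j) (F x)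

section maj
variable {ι V : Type} [Fintype ι] [NormedAddCommGroup V] [NormedSpace ℂ V]

lemma hasSum_congr_pt {A B : Type} [AddCommMonoid B] [TopologicalSpace B] {f g : A → B} {a : B}
    (h : ∀ x, f x = g x) : HasSum f a ↔ HasSum g a := by
  rw [funext h]

lemma norm_word_le (w : List ι) (x : ι → ℂ) (R : ℝ) (hx : ‖x‖ ≤ R) :
    ‖(w.map x).prod‖ ≤ R ^ w.length := by
  induction w with
  | nil => simp
  | cons i w ih =>
    simp only [List.map_cons, List.prod_cons, List.length_cons, norm_mul, pow_succ']
    have : ‖x i‖ ≤ R := (norm_le_pi_norm x i).trans hx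
    gcongr
    exact (norm_nonneg _).trans this

lemma maj_one (R : ℝ) : Maj (ι := ι) 0 R 1 (fun _ => (1 : ℂ)) := by
  refine ⟨Unit, fun _ => [], fun _ => 1, by simp, ⟨1, le_rfl, ?_⟩, fun x hx => ?_⟩
  · simp
  · simp

lemma maj_mono {N R K K'} {F : (ι → ℂ) → V} (h : Maj N R K F) (hK : K ≤ K') : Maj N R K' F := by
  obtain ⟨J, w, a, h1, ⟨k, hk, h2⟩, h3⟩ := h
  exact ⟨J, w, a, h1, ⟨k, hk.trans hK, h2⟩, h3⟩

lemma maj_mul {N M : ℕ} {R K L : ℝ} (hR : 0 ≤ R) {F G : (ι → ℂ) → ℂ}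
    (hF : Maj N R K F) (hG : Maj M R L G) : Maj (N + M) R (K * L) (fun x => F x * G x) := by
  obtain ⟨J, w, a, h1, ⟨k, hk, h2⟩, h3⟩ := hF
  obtain ⟨J', w', a', h1', ⟨k', hk', h2'⟩, h3'⟩ := hG
  have k0 : 0 ≤ k := h2.nonneg (fun j => by positivity)
  have k0' : 0 ≤ k' := h2'.nonneg (fun j => by positivity)
  have hs : Summable (fun p : J × J' => (‖a p.1‖ * R ^ (w p.1).length) *
      (‖a' p.2‖ * R ^ (w' p.2).length)) :=
    h2.summable.mul_of_nonneg h2'.summable (fun j => by positivity) (fun j => by positivity)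
  refine ⟨J × J', fun p => w p.1 ++ w' p.2, fun p => a p.1 * a' p.2, ?_, ⟨k * k', ?_, ?_⟩, ?_⟩
  · intro p; simpa using add_le_add (h1 p.1) (h1' p.2)
  · gcongr; exact k0.trans hk
  · have := h2.mul h2' hs
    refine (hasSum_congr_pt fun p => ?_).mpr this
    simp [pow_add]; ring
  · intro x hx
    have := (h3 x hx).mul (h3' x hx) (f := fun j => ((w j).map x).prod • a j)
      (g := fun j => ((w' j).map x).prod • a' j) ?_
    · refine (hasSum_congr_pt fun p => ?_).mpr this
      simp; ring
    · refine Summable.of_norm_bounded hs fun p => ?_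
      have e1 := norm_word_le (w p.1) x R hx
      have e2 := norm_word_le (w' p.2) x R hx
      simp only [smul_eq_mul, norm_mul]
      rw [mul_comm ‖a p.1‖, mul_comm ‖a' p.2‖]
      gcongr

lemma maj_sum [CompleteSpace V] {A : Type} {N : ℕ} {R S : ℝ} (hR : 0 ≤ R) {F : A → (ι → ℂ) → V}
    {K : A → ℝ} {G : (ι → ℂ) → V} (hF : ∀ n, Maj N R (K n) (F n)) (hK : HasSum K S)
    (hG : ∀ x, ‖x‖ ≤ R → HasSum (fun n => F n x) (G x)) : Maj N R S G := by
  have hF' : ∀ n, ∃ (J : Type) (w : J → List ι) (a : J → V) (k : ℝ), (∀ j, N ≤ (w j).length) ∧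
    k ≤ K n ∧ HasSum (fun j => ‖a j‖ * R ^ (w j).length) k ∧
    ∀ x : ι → ℂ, ‖x‖ ≤ R → HasSum (fun j => ((w j).map x).prod • a j) (F n x) := by
    intro n
    obtain ⟨J, w, a, h1, ⟨k, hk, h2⟩, h3⟩ := hF n
    exact ⟨J, w, a, k, h1, hk, h2, h3⟩
  choose J w a k h1 hk h2 h3 using hF'
  have k0 : ∀ n, 0 ≤ k n := fun n => (h2 n).nonneg (fun j => by positivity)
  have hks : Summable k := Summable.of_nonneg_of_le k0 hk hK.summable
  have hs : Summable (fun p : Σ n, J n => ‖a p.1 p.2‖ * R ^ (w p.1 p.2).length) := by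
    rw [summable_sigma_of_nonneg (fun p => by positivity)]
    exact ⟨fun n => (h2 n).summable, by simpa only [(h2 _).tsum_eq] using hks⟩
  refine ⟨Σ n, J n, fun p => w p.1 p.2, fun p => a p.1 p.2, fun p => h1 p.1 p.2,
    ⟨∑' n, k n, ?_, ?_⟩, ?_⟩
  · rw [← hK.tsum_eq]; exact hks.tsum_le_tsum hk hK.summable
  · have := hs.hasSum.sigma (fun n => h2 n)
    rw [this.tsum_eq]; exact hs.hasSum
  · intro x hx
    have hs' : Summable (fun p : Σ n, J n => ((w p.1 p.2).map x).prod • a p.1 p.2) := by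
      refine Summable.of_norm_bounded hs fun p => ?_
      have e1 := norm_word_le (w p.1 p.2) x R hx
      rw [norm_smul, mul_comm]
      gcongr
    have := hs'.hasSum.sigma (fun n => h3 n x hx)
    rw [(hG x hx).unique this]; exact hs'.hasSum

lemma maj_smul {N : ℕ} {R K : ℝ} {F : (ι → ℂ) → ℂ} (hF : Maj N R K F) (v : V) :
    Maj N R (K * ‖v‖) (fun x => F x • v) := by
  obtain ⟨J, w, a, h1, ⟨k, hk, h2⟩, h3⟩ := hF
  refine ⟨J, w, fun j => a j • v, h1, ⟨k * ‖v‖, by gcongr, ?_⟩, fun x hx => ?_⟩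
  · refine (hasSum_congr_pt fun j => ?_).mpr (h2.mul_right ‖v‖)
    rw [norm_smul]; ring
  · refine (hasSum_congr_pt fun j => ?_).mpr ((h3 x hx).smul_const v)
    rw [smul_smul]; rfl

lemma maj_clm {W : Type} [NormedAddCommGroup W] [NormedSpace ℂ W] [CompleteSpace W]
    {N : ℕ} {R K : ℝ} (hR : 0 ≤ R) {F : (ι → ℂ) → V}
    (hF : Maj N R K F) (T : V →L[ℂ] W) :
    Maj N R (‖T‖ * K) (fun x => T (F x)) := by
  obtain ⟨J, w, a, h1, ⟨k, hk, h2⟩, h3⟩ := hF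
  have hs : Summable (fun j => ‖T (a j)‖ * R ^ (w j).length) := by
    refine Summable.of_nonneg_of_le (fun j => by positivity) (fun j => ?_) (h2.summable.mul_left ‖T‖)
    rw [← mul_assoc]; gcongr; exact T.le_opNorm _
  refine ⟨J, w, fun j => T (a j), h1, ⟨_, ?_, hs.hasSum⟩, fun x hx => ?_⟩
  · rw [← h2.tsum_eq] at hk
    refine le_trans ?_ (mul_le_mul_of_nonneg_left hk (norm_nonneg T))
    rw [← tsum_mul_left]
    refine hs.tsum_le_tsum (fun j => ?_) (h2.summable.mul_left ‖T‖)
    rw [← mul_assoc]; gcongr; exact T.le_opNorm _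
  · convert T.hasSum (h3 x hx) using 2 with j
    simp

lemma maj_bound {N : ℕ} {R K : ℝ} {F : (ι → ℂ) → V}
    (hF : Maj N R K F) {x : ι → ℂ} (hx : ‖x‖ ≤ R) : ‖F x‖ ≤ K := by
  obtain ⟨J, w, a, h1, ⟨k, hk, h2⟩, h3⟩ := hF
  have e : ∀ j, ‖((w j).map x).prod • a j‖ ≤ ‖a j‖ * R ^ (w j).length := fun j => by
    rw [norm_smul, mul_comm]
    have e1 := norm_word_le (w j) x R hx
    gcongr
  rw [← (h3 x hx).tsum_eq]
  exact (tsum_of_norm_bounded h2 e).trans hk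

lemma maj_word {R K : ℝ} (hR : 0 ≤ R) {F : (ι → ℂ) → (ι → ℂ)}
    (hF : ∀ i, Maj 1 R K (fun x => F x i)) (w : List ι) :
    Maj w.length R (K ^ w.length) (fun x => (w.map (F x)).prod) := by
  induction w with
  | nil => simpa using maj_one R
  | cons i w ih =>
    have := maj_mul hR (hF i) ih
    simpa [pow_succ', add_comm] using this

lemma maj_weaken {N M R K} {F : (ι → ℂ) → V} (h : Maj N R K F) (hK : M ≤ N) : Maj M R K F := by
  obtain ⟨J, w, a, h1, ⟨k, hk, h2⟩, h3⟩ := h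
  exact ⟨J, w, a, fun j => hK.trans (h1 j), ⟨k, hk, h2⟩, h3⟩

/-- composition -/
lemma maj_comp [CompleteSpace V] {N : ℕ} {R K ρ : ℝ} (hR : 0 ≤ R) (hρ : 0 ≤ ρ) (hρ1 : ρ ≤ 1)
    {F : (ι → ℂ) → (ι → ℂ)} (hF : ∀ i, Maj 1 R (ρ * R) (fun x => F x i))
    {G : (ι → ℂ) → V} (hG : Maj N R K G) : Maj N R (ρ ^ N * K) (fun x => G (F x)) := by
  obtain ⟨J, w, a, h1, ⟨k, hk, h2⟩, h3⟩ := hG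
  have hb : ∀ j, (ρ * R) ^ (w j).length * ‖a j‖ ≤ ρ ^ N * (‖a j‖ * R ^ (w j).length) := fun j => by
    rw [mul_pow]
    have := pow_le_pow_of_le_one hρ hρ1 (h1 j)
    calc _ = ρ ^ (w j).length * (‖a j‖ * R ^ (w j).length) := by ring
      _ ≤ _ := by gcongr
  have hs : Summable (fun j => (ρ * R) ^ (w j).length * ‖a j‖) :=
    Summable.of_nonneg_of_le (fun j => by positivity) hb (h2.summable.mul_left _)
  have key : Maj N R (∑' j, (ρ * R) ^ (w j).length * ‖a j‖) (fun x => G (F x)) := by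
    refine maj_sum hR (F := fun j x => ((w j).map (F x)).prod • a j) (fun j => ?_) hs.hasSum ?_
    · exact maj_weaken (maj_smul (maj_word hR hF (w j)) (a j)) (h1 j)
    · intro x hx
      apply h3
      refine (pi_norm_le_iff_of_nonneg hR).2 fun i => ?_
      refine (maj_bound (hF i) hx).trans ?_
      nlinarith
  refine maj_mono key ?_
  refine (hs.tsum_le_tsum hb (h2.summable.mul_left _)).trans ?_
  rw [tsum_mul_left, h2.tsum_eq]
  gcongr

lemma maj_scale {N : ℕ} {R R' K : ℝ} (hR : 0 ≤ R') (hRR : R' ≤ R) (hR0 : 0 < R) 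
    {F : (ι → ℂ) → V} (hF : Maj N R K F) : Maj N R' ((R' / R) ^ N * K) F := by
  obtain ⟨J, w, a, h1, ⟨k, hk, h2⟩, h3⟩ := hF
  have hb : ∀ j, ‖a j‖ * R' ^ (w j).length ≤ (R' / R) ^ N * (‖a j‖ * R ^ (w j).length) := fun j => by
    have := pow_le_pow_of_le_one (by positivity : 0 ≤ R' / R) ((div_le_one hR0).2 hRR) (h1 j)
    calc _ = (R' / R) ^ (w j).length * (‖a j‖ * R ^ (w j).length) := by
          rw [div_pow]; field_simp
      _ ≤ _ := by gcongr
  have hs : Summable (fun j => ‖a j‖ * R' ^ (w j).length) :=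
    Summable.of_nonneg_of_le (fun j => by positivity) hb (h2.summable.mul_left _)
  refine ⟨J, w, a, h1, ⟨_, ?_, hs.hasSum⟩, fun x hx => h3 x (hx.trans hRR)⟩
  refine (hs.tsum_le_tsum hb (h2.summable.mul_left _)).trans ?_
  rw [tsum_mul_left, h2.tsum_eq]
  gcongr

lemma maj_add [CompleteSpace V] {N : ℕ} {R K L : ℝ} (hR : 0 ≤ R) {F G : (ι → ℂ) → V}
    (hF : Maj N R K F) (hG : Maj N R L G) : Maj N R (K + L) (fun x => F x + G x) := by
  refine maj_sum (A := Bool) hR (F := fun b => cond b F G) (K := fun b => cond b K L) ?_ ?_ ?_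
  · rintro (_ | _) <;> assumption
  · simpa using hasSum_fintype (fun b => cond b K L)
  · intro x hx
    have := hasSum_fintype (fun b => (cond b F G) x)
    simpa using this

lemma maj_coord {R : ℝ} (i : ι) : Maj 1 R R (fun x => x i) := by
  refine ⟨Unit, fun _ => [i], fun _ => 1, by simp, ⟨R, le_rfl, ?_⟩, fun x hx => ?_⟩
  · simp
  · simp

end maj

section maj
variable {ι V : Type} [Fintype ι] [NormedAddCommGroup V] [NormedSpace ℂ V]

lemma maj_isBigO {N : ℕ} {R K : ℝ} (hR : 0 < R) {F : (ι → ℂ) → V} (hF : Maj N R K F) :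
    F =O[𝓝 0] fun x => ‖x‖ ^ N := by
  refine IsBigO.of_bound (K / R ^ N) ?_
  filter_upwards [Metric.closedBall_mem_nhds (0 : ι → ℂ) hR] with x hx
  rw [mem_closedBall_zero_iff] at hx
  have := maj_bound (maj_scale (norm_nonneg x) hx hR hF) le_rfl
  refine this.trans (le_of_eq ?_)
  simp [div_pow]; ring

/-- multilinear map attached to a word -/
def wordMul [DecidableEq ι] (w : List ι) (k : ℕ) (h : w.length = k) (v : V) :
    ContinuousMultilinearMap ℂ (fun _ : Fin k => (ι → ℂ)) V :=
  (ContinuousLinearMap.toSpanSingleton ℂ v).compContinuousMultilinearMap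
    ((ContinuousMultilinearMap.mkPiAlgebraFin ℂ k ℂ).compContinuousLinearMap
      (fun i => ContinuousLinearMap.proj (w.get (i.cast h.symm))))

lemma wordMul_apply [DecidableEq ι] (w : List ι) (k : ℕ) (h : w.length = k) (v : V) (x : ι → ℂ) :
    wordMul w k h v (fun _ => x) = (w.map x).prod • v := by
  subst h
  simp only [wordMul, ContinuousLinearMap.compContinuousMultilinearMap_coe, Function.comp_apply,
    ContinuousMultilinearMap.compContinuousLinearMap_apply, ContinuousLinearMap.toSpanSingleton_apply,
    ContinuousMultilinearMap.mkPiAlgebraFin_apply, ContinuousLinearMap.proj_apply]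
  congr 2
  apply List.ext_get
  · simp
  · intro n h1 h2; simp

lemma wordMul_norm [DecidableEq ι] (w : List ι) (k : ℕ) (h : w.length = k) (v : V) :
    ‖wordMul w k h v‖ ≤ ‖v‖ := by
  refine ContinuousMultilinearMap.opNorm_le_bound (norm_nonneg _) fun m => ?_
  simp only [wordMul, ContinuousLinearMap.compContinuousMultilinearMap_coe, Function.comp_apply,
    ContinuousMultilinearMap.compContinuousLinearMap_apply, ContinuousLinearMap.toSpanSingleton_apply,
    ContinuousMultilinearMap.mkPiAlgebraFin_apply, ContinuousLinearMap.proj_apply, norm_smul]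
  rw [mul_comm, List.prod_ofFn, norm_prod]
  gcongr with i
  exact norm_le_pi_norm _ _

lemma maj_analytic [CompleteSpace V] {N : ℕ} {R K : ℝ} (hR : 0 < R) {F : (ι → ℂ) → V}
    (hF : Maj N R K F) : AnalyticAt ℂ F 0 := by
  classical
  obtain ⟨J, w, a, h1, ⟨k, hk, h2⟩, h3⟩ := hF
  let E := Equiv.sigmaFiberEquiv (fun j => (w j).length)
  have h2' : Summable (fun q : Σ k, {j // (w j).length = k} => ‖a q.2‖ * R ^ q.1) := by
    have := (E.summable_iff).2 h2.summable
    refine this.congr fun q => ?_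
    obtain ⟨n, j, rfl⟩ := q
    rfl
  have hfib : ∀ n, Summable (fun j : {j // (w j).length = n} => ‖a j‖ * R ^ n) :=
    fun n => h2'.sigma_factor n
  have hfib' : ∀ n, Summable (fun j : {j // (w j).length = n} => ‖a j‖) := fun n => by
    have := (hfib n).mul_right ((R ^ n)⁻¹)
    refine this.congr fun j => ?_
    field_simp
  have hfs : ∀ n, Summable (fun j : {j // (w j).length = n} => wordMul (w j) n j.2 (a j)) :=
    fun n => Summable.of_norm_bounded (hfib' n) fun j => wordMul_norm _ _ _ _
  let p : FormalMultilinearSeries ℂ (ι → ℂ) V := fun n =>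
    ∑' j : {j // (w j).length = n}, wordMul (w j) n j.2 (a j)
  have hp : ∀ n, ‖p n‖ * R ^ n ≤ k := by
    intro n
    calc ‖p n‖ * R ^ n ≤ (∑' j : {j // (w j).length = n}, ‖a j‖) * R ^ n := by
          gcongr
          exact tsum_of_norm_bounded (hfib' n).hasSum fun j => wordMul_norm _ _ _ _
      _ = ∑' j : {j // (w j).length = n}, ‖a j‖ * R ^ n := by rw [tsum_mul_right]
      _ = ∑' j : {j // (w j).length = n}, ‖a j‖ * R ^ (w j).length := by
          refine tsum_congr fun j => ?_
          rw [j.2]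
      _ ≤ k := by
          rw [← h2.tsum_eq]
          exact Summable.tsum_subtype_le (fun j => ‖a j‖ * R ^ (w j).length)
            {j | (w j).length = n} (fun j => by positivity) h2.summable
  refine ⟨p, ENNReal.ofReal R, ?_, by simpa using hR, ?_⟩
  · have := p.le_radius_of_bound (r := R.toNNReal) k (by
      intro n; rw [Real.coe_toNNReal _ hR.le]; exact hp n)
    exact this
  · intro y hy
    have hy' : ‖y‖ ≤ R := by
      rw [Metric.mem_eball, edist_zero_right, ← ofReal_norm] at hy
      exact ((ENNReal.ofReal_lt_ofReal_iff hR).1 hy).le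
    rw [zero_add]
    have e1 : HasSum (fun q : Σ k, {j // (w j).length = k} => ((w q.2).map y).prod • a q.2) (F y) := by
      have := (E.hasSum_iff).2 (h3 y hy')
      refine (hasSum_congr_pt fun q => ?_).1 this
      rfl
    refine e1.sigma fun n => ?_
    have := (ContinuousMultilinearMap.apply ℂ (fun _ : Fin n => (ι → ℂ)) V (fun _ => y)).hasSum
      (hfs n).hasSum
    refine (hasSum_congr_pt fun j => ?_).1 this
    exact wordMul_apply _ _ j.2 _ _

lemma coeff_zero_of_isBigO {E : Type} [NormedAddCommGroup E] [NormedSpace ℂ E]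
    {ψ : E → V} {p : FormalMultilinearSeries ℂ E V}
    (hp : HasFPowerSeriesAt ψ p 0) {N : ℕ} (hN : ψ =O[𝓝 0] fun x => ‖x‖ ^ N) :
    ∀ k < N, ∀ y, p k (fun _ => y) = 0 := by
  intro k
  induction k using Nat.strong_induction_on with
  | _ k ih =>
    intro hk y
    have h1 := hp.isBigO_sub_partialSum_pow (k + 1)
    have h2 : ψ =O[𝓝 0] fun x => ‖x‖ ^ (k + 1) := by
      refine hN.trans (IsBigO.of_bound 1 ?_)
      filter_upwards [Metric.closedBall_mem_nhds (0 : E) one_pos] with x hx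
      rw [mem_closedBall_zero_iff] at hx
      simp only [norm_pow, norm_norm, one_mul]
      exact pow_le_pow_of_le_one (norm_nonneg _) hx hk
    have h3 : (fun y => p k fun _ => y) =O[𝓝 0] fun x => ‖x‖ ^ (k + 1) := by
      refine (h2.sub h1).congr_left fun x => ?_
      simp only [zero_add, sub_sub_cancel, FormalMultilinearSeries.partialSum]
      rw [Finset.sum_range_succ, Finset.sum_eq_zero, zero_add]
      intro j hj
      exact ih j (Finset.mem_range.1 hj) ((Finset.mem_range.1 hj).trans hk) x
    exact h3.continuousMultilinearMap_apply_eq_zero y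

lemma multilinear_expand [DecidableEq ι] {k : ℕ} (p : ContinuousMultilinearMap ℂ (fun _ : Fin k => (ι → ℂ)) V)
    (y : ι → ℂ) :
    p (fun _ => y) = ∑ c : Fin k → ι, (∏ i, y (c i)) • p (fun i => Pi.single (c i) 1) := by
  have e : y = ∑ i, y i • (Pi.single i 1 : ι → ℂ) := by
    ext j; simp [Finset.sum_apply, Pi.single_apply]
  conv_lhs => rw [e]
  rw [ContinuousMultilinearMap.map_sum]
  refine Finset.sum_congr rfl fun c _ => ?_
  rw [ContinuousMultilinearMap.map_smul_univ]

lemma analytic_maj [CompleteSpace V] {N : ℕ} {F : (ι → ℂ) → V} (hF : AnalyticAt ℂ F 0)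
    (hN : F =O[𝓝 0] fun x => ‖x‖ ^ N) : ∃ R > 0, ∃ K, Maj N R K F := by
  classical
  obtain ⟨p, hp⟩ := hF
  have hz := coeff_zero_of_isBigO hp hN
  obtain ⟨r, hr⟩ := hp
  obtain ⟨r', hr'0, hr'⟩ := ENNReal.lt_iff_exists_nnreal_btwn.1 hr.r_pos
  have hr'0 : 0 < (r' : ℝ) := by exact_mod_cast hr'0
  have hsum := p.summable_norm_mul_pow (hr'.trans_le hr.r_le)
  set d : ℝ := Fintype.card ι + 1 with hd
  have hdp : 1 ≤ d := by rw [hd]; simp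
  set R := r' / d with hRdef
  have hR : 0 < R := by positivity
  have hRr : R ≤ r' := by rw [hRdef]; exact div_le_self hr'0.le hdp
  let c (q : Σ k : ℕ, Fin (k + N) → ι) : V := p (q.1 + N) (fun i => Pi.single (q.2 i) 1)
  have hc : ∀ q, ‖c q‖ ≤ ‖p (q.1 + N)‖ := fun q => by
    refine ((p (q.1 + N)).le_opNorm _).trans (le_of_eq ?_)
    rw [Finset.prod_eq_one, mul_one]
    intro i _
    rw [Pi.norm_single, norm_one]
  have hs : Summable (fun q : Σ k : ℕ, Fin (k + N) → ι => ‖c q‖ * R ^ (q.1 + N)) := by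
    rw [summable_sigma_of_nonneg (fun q => by positivity)]
    refine ⟨fun n => Summable.of_finite, ?_⟩
    refine Summable.of_nonneg_of_le (fun n => tsum_nonneg fun b => by positivity) (fun n => ?_)
      ((summable_nat_add_iff N).2 hsum)
    rw [tsum_fintype]
    calc _ ≤ ∑ b : Fin (n + N) → ι, ‖p (n + N)‖ * R ^ (n + N) := by
          gcongr with b
          exact hc ⟨n, b⟩
      _ = (Fintype.card ι : ℝ) ^ (n + N) * (‖p (n + N)‖ * R ^ (n + N)) := by simp
      _ ≤ d ^ (n + N) * (‖p (n + N)‖ * R ^ (n + N)) := by gcongr; rw [hd]; simp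
      _ = _ := by rw [hRdef, div_pow]; field_simp
  refine ⟨R, hR, ∑' q : Σ k : ℕ, Fin (k + N) → ι, ‖c q‖ * R ^ (q.1 + N),
    Σ k : ℕ, Fin (k + N) → ι, fun q => List.ofFn q.2, c, ?_, ⟨_, le_rfl, ?_⟩, ?_⟩
  · intro q; simp
  · simpa using hs.hasSum
  · intro x hx
    have hs' : Summable (fun q : Σ k : ℕ, Fin (k + N) → ι => ((List.ofFn q.2).map x).prod • c q) := by
      refine Summable.of_norm_bounded hs fun q => ?_
      have e1 := norm_word_le (List.ofFn q.2) x R hx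
      rw [List.length_ofFn] at e1
      rw [norm_smul, mul_comm]
      gcongr
    have h1 := hs'.hasSum.sigma (g := fun n => p (n + N) (fun _ => x)) (fun n => by
      rw [multilinear_expand]
      have := hasSum_fintype (fun b : Fin (n + N) → ι => ((List.ofFn b).map x).prod • c ⟨n, b⟩)
      convert this using 2 with b
      simp [List.prod_ofFn, c])
    have h2 : HasSum (fun n => p n (fun _ => x)) (F x) := by
      have := hr.hasSum (y := x) (by
        rw [Metric.mem_eball, edist_zero_right, ← ofReal_norm]
        refine lt_of_le_of_lt ?_ hr'
        rw [← ENNReal.ofReal_coe_nnreal]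
        exact ENNReal.ofReal_le_ofReal (hx.trans hRr))
      simpa using this
    have h3 := (hasSum_nat_add_iff' N).2 h2
    rw [Finset.sum_eq_zero (fun k hk => hz k (Finset.mem_range.1 hk) x), sub_zero] at h3
    rw [h3.unique h1]
    exact hs'.hasSum

end maj

/-- germ with diagonal contracting linear part -/
structure GoodGerm {ι : Type} [Fintype ι] (F : (ι → ℂ) → (ι → ℂ)) (μ : ι → ℂ) : Prop where
  an : AnalyticAt ℂ F 0
  lin : ∀ i, (fun x => F x i - μ i * x i) =O[𝓝 0] fun x => ‖x‖ ^ 2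
  con : ∀ i, ‖μ i‖ < 1

section good
variable {ι V : Type} [Fintype ι] [NormedAddCommGroup V] [NormedSpace ℂ V] 
  {F : (ι → ℂ) → (ι → ℂ)} {μ : ι → ℂ}

lemma isBigO_zero {E W : Type} [NormedAddCommGroup E] [NormedAddCommGroup W] {ψ : E → W} {m : ℕ}
    (hm : 0 < m) (h : ψ =O[𝓝 0] fun x => ‖x‖ ^ m) : ψ 0 = 0 := by
  obtain ⟨c, hc⟩ := h.bound
  have := hc.self_of_nhds
  simpa [hm.ne'] using this

lemma GoodGerm.zero (h : GoodGerm F μ) : F 0 = 0 := by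
  ext i
  simpa using isBigO_zero two_pos (h.lin i)

lemma analytic_coord (i : ι) : AnalyticAt ℂ (fun x : ι → ℂ => x i) 0 :=
  (ContinuousLinearMap.proj (R := ℂ) (φ := fun _ : ι => ℂ) i).analyticAt 0

lemma GoodGerm.an_coord (h : GoodGerm F μ) (i : ι) : AnalyticAt ℂ (fun x => F x i) 0 := by
  have := (ContinuousLinearMap.proj (R := ℂ) (φ := fun _ : ι => ℂ) i).analyticAt (F 0)
  exact this.comp h.an

lemma GoodGerm.an_comp (h : GoodGerm F μ) {ψ : (ι → ℂ) → V} (hψ : AnalyticAt ℂ ψ 0) :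
    AnalyticAt ℂ (fun x => ψ (F x)) 0 := by
  rw [← h.zero] at hψ
  exact hψ.comp h.an

lemma GoodGerm.tendsto (h : GoodGerm F μ) : Tendsto F (𝓝 0) (𝓝 0) := by
  have := h.an.continuousAt.tendsto
  rwa [h.zero] at this

lemma coord_isBigO (i : ι) : (fun x : ι → ℂ => x i) =O[𝓝 0] fun x => ‖x‖ ^ 1 :=
  IsBigO.of_bound 1 (Eventually.of_forall fun x => by simpa using norm_le_pi_norm x i)

lemma isBigO_pow_le {E : Type} [NormedAddCommGroup E] {m n : ℕ} (h : m ≤ n) :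
    (fun x : E => ‖x‖ ^ n) =O[𝓝 0] fun x => ‖x‖ ^ m := by
  refine IsBigO.of_bound 1 ?_
  filter_upwards [Metric.closedBall_mem_nhds (0 : E) one_pos] with x hx
  rw [mem_closedBall_zero_iff] at hx
  simp only [norm_pow, norm_norm, one_mul]
  exact pow_le_pow_of_le_one (norm_nonneg _) hx h

lemma GoodGerm.coord_isBigO (h : GoodGerm F μ) (i : ι) :
    (fun x => F x i) =O[𝓝 0] fun x => ‖x‖ ^ 1 := by
  have h1 := ((h.lin i).trans (isBigO_pow_le one_le_two)).add
    ((_root_.coord_isBigO i).const_mul_left (μ i))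
  simpa using h1

lemma GoodGerm.isBigO (h : GoodGerm F μ) : F =O[𝓝 0] fun x => ‖x‖ :=
  isBigO_pi.2 fun i => by simpa using h.coord_isBigO i

lemma GoodGerm.isBigO_comp (h : GoodGerm F μ) {ψ : (ι → ℂ) → V} {m : ℕ}
    (hψ : ψ =O[𝓝 0] fun x => ‖x‖ ^ m) : (fun x => ψ (F x)) =O[𝓝 0] fun x => ‖x‖ ^ m :=
  (hψ.comp_tendsto h.tendsto).trans (h.isBigO.norm_left.pow m)

lemma GoodGerm.maj (h : GoodGerm F μ) :
    ∃ ρ : ℝ, 0 < ρ ∧ ρ < 1 ∧ ∀ᶠ R in 𝓝[>] (0 : ℝ), ∀ i, Maj 1 R (ρ * R) (fun x => F x i) := by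
  have hμ : ‖μ‖ < 1 := (pi_norm_lt_iff one_pos).2 h.con
  have h0 := norm_nonneg μ
  refine ⟨(‖μ‖ + 1) / 2, by linarith, by linarith, ?_⟩
  rw [eventually_all]
  intro i
  have ha : AnalyticAt ℂ (fun x => F x i - μ i * x i) 0 :=
    (h.an_coord i).sub (analyticAt_const.mul (analytic_coord i))
  obtain ⟨R0, hR0, K, hK⟩ := analytic_maj ha (h.lin i)
  have ht : Tendsto (fun R : ℝ => R * (K / R0 ^ 2)) (𝓝[>] 0) (𝓝 0) := by
    have : Tendsto (fun R : ℝ => R * (K / R0 ^ 2)) (𝓝 0) (𝓝 (0 * (K / R0 ^ 2))) :=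
      (continuous_id.mul continuous_const).tendsto 0
    rw [zero_mul] at this
    exact this.mono_left nhdsWithin_le_nhds
  have e1 := ht.eventually (gt_mem_nhds (show 0 < (1 - ‖μ‖) / 2 by linarith))
  have e2 : ∀ᶠ R in 𝓝[>] (0 : ℝ), R < R0 := nhdsWithin_le_nhds (gt_mem_nhds hR0)
  filter_upwards [e1, e2, self_mem_nhdsWithin] with R h1 h2 h3
  have h3 : 0 < R := h3
  have m1 := maj_weaken (maj_scale h3.le h2.le hR0 hK) one_le_two
  have m2 := maj_smul (V := ℂ) (maj_coord (R := R) i) (μ i)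
  have m3 := maj_add h3.le m1 m2
  have : (fun x => F x i) = fun x => (F x i - μ i * x i) + x i • μ i := by
    ext x; simp; ring
  rw [this]
  refine maj_mono m3 ?_
  have : (R / R0) ^ 2 * K = R * (R * (K / R0 ^ 2)) := by field_simp
  rw [this]
  have h4 := norm_le_pi_norm μ i
  nlinarith

lemma GoodGerm.solve [CompleteSpace V] (h : GoodGerm F μ) (M T : V →L[ℂ] V)
    (hMT : ∀ v, M (T v) = v) :
    ∃ N : ℕ, ∀ m, N ≤ m → ∀ ψ : (ι → ℂ) → V, AnalyticAt ℂ ψ 0 → (ψ =O[𝓝 0] fun x => ‖x‖ ^ m) →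
      ∃ ϕ : (ι → ℂ) → V, AnalyticAt ℂ ϕ 0 ∧ (ϕ =O[𝓝 0] fun x => ‖x‖ ^ m) ∧
        ∀ᶠ x in 𝓝 0, ϕ (F x) - M (ϕ x) = ψ x := by
  obtain ⟨ρ, hρ0, hρ1, hR⟩ := h.maj
  have ht : Tendsto (fun n : ℕ => ‖T‖ * ρ ^ n) atTop (𝓝 0) := by
    simpa using (tendsto_pow_atTop_nhds_zero_of_lt_one hρ0.le hρ1).const_mul ‖T‖
  obtain ⟨N, hN⟩ := eventually_atTop.1 (ht.eventually (gt_mem_nhds one_pos))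
  refine ⟨N, fun m hm ψ hψ hψm => ?_⟩
  have hlt := hN m hm
  obtain ⟨R1, hR1, K, hK⟩ := analytic_maj hψ hψm
  have e2 : ∀ᶠ R in 𝓝[>] (0 : ℝ), R < R1 := nhdsWithin_le_nhds (gt_mem_nhds hR1)
  obtain ⟨R, hF, hRlt, hR0⟩ := (hR.and (e2.and self_mem_nhdsWithin)).exists
  have hR0 : 0 < R := hR0
  have hψR := maj_scale hR0.le hRlt.le hR1 hK
  set K' := (R / R1) ^ m * K
  have hit : ∀ n, Maj m R ((ρ ^ m) ^ n * K') (fun x => ψ (F^[n] x)) := by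
    intro n
    induction n with
    | zero => simpa using hψR
    | succ n ih =>
      have := maj_comp hR0.le hρ0.le hρ1.le hF ih
      simpa [pow_succ', mul_assoc] using this
  have hK0 : 0 ≤ K' := (norm_nonneg _).trans (maj_bound hψR (x := 0) (by simpa using hR0.le))
  have hT : ∀ n, Maj m R (‖T‖ * K' * (‖T‖ * ρ ^ m) ^ n) (fun x => (T ^ (n + 1)) (ψ (F^[n] x))) := by
    intro n
    refine maj_mono (maj_clm hR0.le (hit n) (T ^ (n + 1))) ?_
    calc _ ≤ ‖T‖ ^ (n + 1) * ((ρ ^ m) ^ n * K') := by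
          gcongr; exact norm_pow_le' T (Nat.succ_pos n)
      _ = _ := by rw [mul_pow]; ring
  have hgs : Summable (fun n : ℕ => ‖T‖ * K' * (‖T‖ * ρ ^ m) ^ n) :=
    (summable_geometric_of_lt_one (by positivity) hlt).mul_left _
  have hs : ∀ x, ‖x‖ ≤ R → Summable (fun n => (T ^ (n + 1)) (ψ (F^[n] x))) := fun x hx =>
    Summable.of_norm_bounded hgs fun n => maj_bound (hT n) hx
  have hmaj : Maj m R _ (fun x => ∑' n, (T ^ (n + 1)) (ψ (F^[n] x))) :=
    maj_sum hR0.le hT hgs.hasSum fun x hx => (hs x hx).hasSum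
  refine ⟨fun x => -∑' n, (T ^ (n + 1)) (ψ (F^[n] x)), (maj_analytic hR0 hmaj).neg,
    (maj_isBigO hR0 hmaj).neg_left, ?_⟩
  filter_upwards [Metric.closedBall_mem_nhds (0 : ι → ℂ) hR0] with x hx
  rw [mem_closedBall_zero_iff] at hx
  have hFx : ‖F x‖ ≤ R := (pi_norm_le_iff_of_nonneg hR0.le).2 fun i =>
    (maj_bound (hF i) hx).trans (by nlinarith)
  have h1 := M.hasSum (hs x hx).hasSum
  have h2 := (hasSum_nat_add_iff' 1).2 h1
  have h3 := (hs _ hFx).hasSum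
  have h4 := h2.unique ((hasSum_congr_pt fun n => by
    simp only [pow_succ' T (n + 1)]
    change M (T _) = _
    rw [hMT, Function.iterate_succ, Function.comp_apply]
    rfl).2 h3)
  simp only [Finset.range_one, Finset.sum_singleton] at h4
  rw [← h4]
  simp [hMT]

end good

section step
variable {ι : Type} [Fintype ι] {F : (ι → ℂ) → (ι → ℂ)} {μ : ι → ℂ}

lemma prod_isBigO {E A : Type} [NormedAddCommGroup E] (a : A → E → ℂ)
    (ha : ∀ i, a i =O[𝓝 0] fun x => ‖x‖ ^ 1) (S : Finset A) :
    (fun x => ∏ i ∈ S, a i x) =O[𝓝 0] fun x => ‖x‖ ^ S.card := by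
  have := IsBigO.finsetProd (s := S) (f := a) (g := fun _ x => ‖x‖ ^ 1) (l := 𝓝 0) (fun i _ => ha i)
  simpa using this

lemma prod_sub_isBigO {E A : Type} [NormedAddCommGroup E] (a b : A → E → ℂ)
    (ha : ∀ i, a i =O[𝓝 0] fun x => ‖x‖ ^ 1)
    (hab : ∀ i, (fun x => a i x - b i x) =O[𝓝 0] fun x => ‖x‖ ^ 2) (S : Finset A) :
    (fun x => ∏ i ∈ S, a i x - ∏ i ∈ S, b i x) =O[𝓝 0] fun x => ‖x‖ ^ (S.card + 1) := by
  classical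
  have hb : ∀ i, b i =O[𝓝 0] fun x => ‖x‖ ^ 1 := fun i => by
    have := (ha i).sub ((hab i).trans (isBigO_pow_le one_le_two))
    simpa using this
  induction S using Finset.induction_on with
  | empty => simpa using Asymptotics.isBigO_zero _ _
  | insert i S hi ih =>
    have h1 := (hab i).mul (prod_isBigO a ha S)
    have h2 := (hb i).mul ih
    have e : S.card + 1 + 1 = 2 + S.card := by omega
    have e' : S.card + 1 + 1 = 1 + (S.card + 1) := by omega
    rw [Finset.card_insert_of_notMem hi]
    simp only [← pow_add] at h1 h2
    rw [← e] at h1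
    rw [← e'] at h2
    refine (h1.add h2).congr_left fun x => ?_
    rw [Finset.prod_insert hi, Finset.prod_insert hi]
    ring

lemma isBigO_smul_const {E V : Type} [NormedAddCommGroup E] [NormedAddCommGroup V] [NormedSpace ℂ V]
    {g : E → ℝ} {f : E → ℂ} (h : f =O[𝓝 0] g) (v : V) : (fun x => f x • v) =O[𝓝 0] g := by
  refine IsBigO.trans (IsBigO.of_bound ‖v‖ (Eventually.of_forall fun x => ?_)) h
  rw [norm_smul, mul_comm]

lemma GoodGerm.step (h : GoodGerm F μ) {p : ℕ} (M : Matrix (Fin p) (Fin p) ℂ) (m : ℕ)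
    (ψ : (ι → ℂ) → (Fin p → ℂ)) (hψ : AnalyticAt ℂ ψ 0) (hψm : ψ =O[𝓝 0] fun x => ‖x‖ ^ m) :
    ∃ (ϕ : (ι → ℂ) → (Fin p → ℂ)) (q : (Fin m → ι) → (Fin p → ℂ)),
      AnalyticAt ℂ ϕ 0 ∧ (ϕ =O[𝓝 0] fun x => ‖x‖ ^ m) ∧
      (∀ c, q c ≠ 0 → (M - (∏ i, μ (c i)) • (1 : Matrix (Fin p) (Fin p) ℂ)).det = 0) ∧
      (fun x => ψ x - (ϕ (F x) - M.mulVec (ϕ x)) - ∑ c, (∏ i, x (c i)) • q c)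
        =O[𝓝 0] fun x => ‖x‖ ^ (m + 1) := by
  classical
  obtain ⟨P, hP⟩ := hψ
  have hz := coeff_zero_of_isBigO hP hψm
  have h1 := hP.isBigO_sub_partialSum_pow (m + 1)
  let Pc (c : Fin m → ι) : Fin p → ℂ := P m (fun i => Pi.single (c i) 1)
  have h2 : (fun x => ψ x - ∑ c : Fin m → ι, (∏ i, x (c i)) • Pc c) =O[𝓝 0]
      fun x => ‖x‖ ^ (m + 1) := by
    refine h1.congr_left fun x => ?_
    simp only [zero_add, FormalMultilinearSeries.partialSum]
    rw [Finset.sum_range_succ, Finset.sum_eq_zero, zero_add, multilinear_expand]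
    intro j hj
    exact hz j (Finset.mem_range.1 hj) x
  let A (c : Fin m → ι) : Matrix (Fin p) (Fin p) ℂ := M - (∏ i, μ (c i)) • 1
  let v (c : Fin m → ι) : Fin p → ℂ := if (A c).det = 0 then 0 else -((A c)⁻¹.mulVec (Pc c))
  let q (c : Fin m → ι) : Fin p → ℂ := if (A c).det = 0 then Pc c else 0
  have hAv : ∀ c, Pc c = (∏ i, μ (c i)) • v c - M.mulVec (v c) + q c := by
    intro c
    by_cases hc : (A c).det = 0
    · simp [v, q, hc]
    · have e : (∏ i, μ (c i)) • v c - M.mulVec (v c) = -((A c).mulVec (v c)) := by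
        simp [A, Matrix.sub_mulVec, Matrix.smul_mulVec]
      rw [e]
      simp only [v, q, hc, if_false, Matrix.mulVec_neg, neg_neg, add_zero, Matrix.mulVec_mulVec]
      rw [Matrix.mul_nonsing_inv _ (isUnit_iff_ne_zero.2 hc), Matrix.one_mulVec]
  refine ⟨fun x => ∑ c : Fin m → ι, (∏ i, x (c i)) • v c, q, ?_, ?_, ?_, ?_⟩
  · refine Finset.analyticAt_fun_sum _ fun c _ => ?_
    exact (Finset.analyticAt_fun_prod _ fun i _ => analytic_coord (c i)).smul analyticAt_const
  · refine IsBigO.fun_sum fun c _ => ?_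
    refine isBigO_smul_const ?_ _
    simpa using prod_isBigO (fun (i : Fin m) (x : ι → ℂ) => x (c i)) (fun i => _root_.coord_isBigO (c i)) Finset.univ
  · intro c hc
    by_contra hne
    exact hc (if_neg hne)
  · have h3 : ∀ c : Fin m → ι, (fun x => ((∏ i, F x (c i)) - ∏ i, μ (c i) * x (c i)) • v c)
        =O[𝓝 0] fun x => ‖x‖ ^ (m + 1) := by
      intro c
      refine isBigO_smul_const ?_ _
      have := prod_sub_isBigO (fun (i : Fin m) (x : ι → ℂ) => F x (c i))
        (fun (i : Fin m) (x : ι → ℂ) => μ (c i) * x (c i))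
        (fun i => h.coord_isBigO (c i)) (fun i => h.lin (c i)) Finset.univ
      simpa using this
    have h4 := h2.sub (IsBigO.fun_sum (s := Finset.univ) fun c _ => h3 c)
    refine h4.congr_left fun x => ?_
    rw [Matrix.mulVec_sum, sub_sub, sub_sub, ← Finset.sum_sub_distrib, ← Finset.sum_add_distrib,
      ← Finset.sum_add_distrib]
    congr 1
    refine Finset.sum_congr rfl fun c _ => ?_
    rw [hAv c, Matrix.mulVec_smul, Finset.prod_mul_distrib]
    module

end step

section norml

lemma analytic_isBigO_one {E V : Type} [NormedAddCommGroup E] [NormedSpace ℂ E]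
    [NormedAddCommGroup V] [NormedSpace ℂ V] {f : E → V} (hf : AnalyticAt ℂ f 0) (h0 : f 0 = 0) :
    f =O[𝓝 0] fun x => ‖x‖ ^ 1 := by
  have := hf.differentiableAt.isBigO_sub
  simp only [h0, sub_zero] at this
  simpa using this.norm_right

lemma analytic_eval {E : Type} [NormedAddCommGroup E] [NormedSpace ℂ E] {s : ℕ}
    {X : E → Fin s → ℂ} (hX : ∀ k, AnalyticAt ℂ (fun x => X x k) 0) (P : MvPolynomial (Fin s) ℂ) :
    AnalyticAt ℂ (fun x => MvPolynomial.eval (X x) P) 0 := by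
  have := AnalyticAt.aeval_mvPolynomial hX P
  simpa [MvPolynomial.aeval_eq_eval] using this

lemma coeff_word {s m : ℕ} (k : Fin m → Fin s) (lam : Fin s → ℂ) (n : Fin s →₀ ℕ)
    (hn : MvPolynomial.coeff n (∏ i, (MvPolynomial.X (k i) : MvPolynomial (Fin s) ℂ)) ≠ 0) :
    (n.sum fun _ a => a) = m ∧ ∏ l, lam l ^ n l = ∏ i, lam (k i) := by
  have e : ∏ i, (MvPolynomial.X (k i) : MvPolynomial (Fin s) ℂ) =
      MvPolynomial.monomial (∑ i, Finsupp.single (k i) 1) 1 := by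
    rw [MvPolynomial.monomial_sum_one]; rfl
  have hn' := hn
  rw [e, MvPolynomial.coeff_monomial] at hn'
  have hn2 : ∑ i, Finsupp.single (k i) 1 = n := by
    by_contra hne; exact hn' (if_neg hne)
  constructor
  · have : n.degree = m := by
      rw [← hn2, map_sum]; simp
    rw [← this]; rfl
  · have := congrArg (MvPolynomial.eval lam) e
    rw [hn2, MvPolynomial.eval_monomial, map_prod, Finsupp.prod_fintype _ _ (by simp)] at this
    simpa using this.symm

variable {s : ℕ} {κ : Type} [Fintype κ] {F : ((Fin s ⊕ κ) → ℂ) → ((Fin s ⊕ κ) → ℂ)}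
  {μ : (Fin s ⊕ κ) → ℂ}

lemma GoodGerm.normalize (h : GoodGerm F μ) (hμ0 : ∀ a, μ (Sum.inr a) = 0) {p : ℕ}
    (M : Matrix (Fin p) (Fin p) ℂ) (hM : M.det ≠ 0)
    (X : ((Fin s ⊕ κ) → ℂ) → Fin s → ℂ) (hXa : ∀ k, AnalyticAt ℂ (fun x => X x k) 0)
    (hX : ∀ k, (fun x => x (Sum.inl k) - X x k) =O[𝓝 0] fun x => ‖x‖ ^ 2)
    (Λ : ℂ → ℂ) (hΛa : AnalyticAt ℂ Λ 0) (hΛ0 : Λ 0 = 0)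
    (hΛ : (fun z : ℂ × ℂ => Λ (z.1 + z.2) - Λ z.1 - z.2) =O[𝓝 0] fun z => (‖z.1‖ + ‖z.2‖) * ‖z.2‖)
    (m0 : ℕ) (hm0 : 1 ≤ m0)
    (ψ : ((Fin s ⊕ κ) → ℂ) → (Fin p → ℂ)) (hψ : AnalyticAt ℂ ψ 0)
    (hψm : ψ =O[𝓝 0] fun x => ‖x‖ ^ m0) :
    ∃ (ϕ : ((Fin s ⊕ κ) → ℂ) → (Fin p → ℂ)) (gp : Fin p → MvPolynomial (Fin s) ℂ),
      AnalyticAt ℂ ϕ 0 ∧ (ϕ =O[𝓝 0] fun x => ‖x‖ ^ m0) ∧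
      (∀ j n, MvPolynomial.coeff n (gp j) ≠ 0 → m0 ≤ (n.sum fun _ a => a) ∧
        (M - (∏ l, μ (Sum.inl l) ^ n l) • (1 : Matrix (Fin p) (Fin p) ℂ)).det = 0) ∧
      ∀ᶠ x in 𝓝 0, ϕ (F x) - M.mulVec (ϕ x) =
        fun j => ψ x j + Λ (MvPolynomial.eval (X x) (gp j)) := by
  classical
  have hX0 : X 0 = 0 := by
    ext k; have := isBigO_zero two_pos (hX k); simpa using this
  have hX1 : ∀ k, (fun x => X x k) =O[𝓝 0] fun x => ‖x‖ ^ 1 := fun k =>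
    analytic_isBigO_one (hXa k) (by rw [hX0]; rfl)
  have hMc : ∀ {ϕ : ((Fin s ⊕ κ) → ℂ) → (Fin p → ℂ)}, AnalyticAt ℂ ϕ 0 →
      AnalyticAt ℂ (fun x => M.mulVec (ϕ x)) 0 := fun {ϕ} hϕ => by
    have := (LinearMap.toContinuousLinearMap (Matrix.toLin' M)).analyticAt (ϕ 0)
    exact this.comp hϕ
  have hgz : ∀ P : MvPolynomial (Fin s) ℂ,
      (∀ n, MvPolynomial.coeff n P ≠ 0 → m0 ≤ (n.sum fun _ a => a)) →
      MvPolynomial.eval (X 0) P = 0 := fun P hP => by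
    rw [hX0, MvPolynomial.eval_zero, MvPolynomial.constantCoeff_eq]
    by_contra hne
    have := hP 0 hne
    simp at this
    omega
  -- the residual
  let Res (ϕ : ((Fin s ⊕ κ) → ℂ) → (Fin p → ℂ)) (gp : Fin p → MvPolynomial (Fin s) ℂ)
    (x : (Fin s ⊕ κ) → ℂ) : Fin p → ℂ :=
    (fun j => ψ x j + Λ (MvPolynomial.eval (X x) (gp j))) - (ϕ (F x) - M.mulVec (ϕ x))
  have hRes : ∀ ϕ gp, AnalyticAt ℂ ϕ 0 → 
      (∀ j n, MvPolynomial.coeff n (gp j) ≠ 0 → m0 ≤ (n.sum fun _ a => a)) →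
      AnalyticAt ℂ (Res ϕ gp) 0 := by
    intro ϕ gp hϕ hgp
    refine AnalyticAt.sub ?_ ((h.an_comp hϕ).sub (hMc hϕ))
    refine AnalyticAt.pi fun j => ?_
    refine AnalyticAt.add ?_ ?_
    · exact ((ContinuousLinearMap.proj (R := ℂ) (φ := fun _ : Fin p => ℂ) j).analyticAt (ψ 0)).comp hψ
    · have e := hgz (gp j) (hgp j)
      rw [← e] at hΛa
      exact hΛa.comp (f := fun x => MvPolynomial.eval (X x) (gp j)) (analytic_eval hXa (gp j))
  have key : ∀ m, m0 ≤ m → ∃ (ϕ : ((Fin s ⊕ κ) → ℂ) → (Fin p → ℂ))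
      (gp : Fin p → MvPolynomial (Fin s) ℂ),
      AnalyticAt ℂ ϕ 0 ∧ (ϕ =O[𝓝 0] fun x => ‖x‖ ^ m0) ∧
      (∀ j n, MvPolynomial.coeff n (gp j) ≠ 0 → m0 ≤ (n.sum fun _ a => a) ∧
        (M - (∏ l, μ (Sum.inl l) ^ n l) • (1 : Matrix (Fin p) (Fin p) ℂ)).det = 0) ∧
      Res ϕ gp =O[𝓝 0] fun x => ‖x‖ ^ m := by
    intro m hm
    induction m, hm using Nat.le_induction with
    | base =>
      refine ⟨fun _ => 0, fun _ => 0, analyticAt_const, Asymptotics.isBigO_zero _ _, by simp, ?_⟩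
      refine hψm.congr_left fun x => ?_
      simp [Res, hΛ0]
    | succ m hm ih =>
      obtain ⟨ϕ, gp, hϕa, hϕm, hgp, hR⟩ := ih
      obtain ⟨ϕ', q, hϕ'a, hϕ'm, hq, hR'⟩ := h.step M m _
        (hRes ϕ gp hϕa fun j n hn => (hgp j n hn).1) hR
      let τ : (Fin s ⊕ κ) → MvPolynomial (Fin s) ℂ := Sum.elim MvPolynomial.X (fun _ => 0)
      let Xh (i : Fin s ⊕ κ) (x : (Fin s ⊕ κ) → ℂ) : ℂ := MvPolynomial.eval (X x) (τ i)
      have hXh1 : ∀ i, Xh i =O[𝓝 0] fun x => ‖x‖ ^ 1 := by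
        rintro (k | a)
        · refine (hX1 k).congr_left fun x => ?_
          simp [Xh, τ]
        · refine (Asymptotics.isBigO_zero _ _).congr_left fun x => ?_
          simp [Xh, τ]
      have hinl : ∀ c, q c ≠ 0 → ∃ k : Fin m → Fin s, ∀ i, c i = Sum.inl (k i) := by
        intro c hc
        have h1 := hq c hc
        have h2 : ∏ i, μ (c i) ≠ 0 := by
          intro h0
          rw [h0, zero_smul, sub_zero] at h1
          exact hM h1
        have h3 : ∀ i, ∃ k, c i = Sum.inl k := by
          intro i
          rcases hci : c i with k | a
          · exact ⟨k, rfl⟩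
          · exact absurd (by rw [hci, hμ0]) (Finset.prod_ne_zero_iff.1 h2 i (Finset.mem_univ i))
        exact ⟨fun i => (h3 i).choose, fun i => (h3 i).choose_spec⟩
      let gq (j : Fin p) : MvPolynomial (Fin s) ℂ := ∑ c : Fin m → Fin s ⊕ κ,
        MvPolynomial.C (q c j) * ∏ i, τ (c i)
      have hgq : ∀ j n, MvPolynomial.coeff n (gq j) ≠ 0 → (n.sum fun _ a => a) = m ∧
        (M - (∏ l, μ (Sum.inl l) ^ n l) • (1 : Matrix (Fin p) (Fin p) ℂ)).det = 0 := by
        intro j n hn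
        simp only [gq, MvPolynomial.coeff_sum] at hn
        obtain ⟨c, -, hc⟩ := Finset.exists_ne_zero_of_sum_ne_zero hn
        rw [MvPolynomial.coeff_C_mul] at hc
        have hqc : q c ≠ 0 := fun h0 => hc (by simp [h0])
        obtain ⟨k, hk⟩ := hinl c hqc
        have hc2 := right_ne_zero_of_mul hc
        simp only [hk, τ, Sum.elim_inl] at hc2
        obtain ⟨e1, e2⟩ := coeff_word k (fun l => μ (Sum.inl l)) n hc2
        refine ⟨e1, ?_⟩
        rw [e2]
        have := hq c hqc
        simpa only [hk] using this
      have hev : ∀ j x, MvPolynomial.eval (X x) (gq j) = ∑ c, q c j * ∏ i, Xh (c i) x := by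
        intro j x
        simp [gq, Xh, map_sum, map_prod]
      refine ⟨fun x => ϕ x + ϕ' x, fun j => gp j - gq j, hϕa.add hϕ'a,
        hϕm.add (hϕ'm.trans (isBigO_pow_le hm)), ?_, ?_⟩
      · intro j n hn
        rw [MvPolynomial.coeff_sub] at hn
        by_cases h0 : MvPolynomial.coeff n (gp j) = 0
        · have : MvPolynomial.coeff n (gq j) ≠ 0 := fun h1 => hn (by rw [h0, h1, sub_zero])
          obtain ⟨e1, e2⟩ := hgq j n this
          exact ⟨e1 ▸ hm, e2⟩
        · exact hgp j n h0
      · rw [isBigO_pi] at hR' ⊢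
        intro j
        -- replacement of coordinates
        have t1 : (fun x => ∑ c, (∏ i, x (c i) - ∏ i, Xh (c i) x) * q c j) =O[𝓝 0]
            fun x => ‖x‖ ^ (m + 1) := by
          refine IsBigO.fun_sum fun c _ => ?_
          by_cases hc : q c = 0
          · simpa [hc] using Asymptotics.isBigO_zero _ _
          · obtain ⟨k, hk⟩ := hinl c hc
            refine isBigO_smul_const (V := ℂ) ?_ (q c j)
            have := prod_sub_isBigO (fun (i : Fin m) (x : (Fin s ⊕ κ) → ℂ) => x (c i))
              (fun i x => Xh (c i) x) (fun i => _root_.coord_isBigO (c i))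
              (fun i => by
                refine (hX (k i)).congr_left fun x => ?_
                simp [hk, Xh, τ]) Finset.univ
            simpa using this
        let a (x : (Fin s ⊕ κ) → ℂ) : ℂ := MvPolynomial.eval (X x) (gp j)
        let b (x : (Fin s ⊕ κ) → ℂ) : ℂ := -MvPolynomial.eval (X x) (gq j)
        have ha : a =O[𝓝 0] fun x => ‖x‖ ^ 1 :=
          analytic_isBigO_one (analytic_eval hXa _) (hgz _ fun n hn => (hgp j n hn).1)
        have hb : b =O[𝓝 0] fun x => ‖x‖ ^ m := by
          simp only [b, hev]
          refine IsBigO.neg_left (IsBigO.fun_sum fun c _ => ?_)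
          refine IsBigO.const_mul_left ?_ _
          have := prod_isBigO (fun (i : Fin m) x => Xh (c i) x) (fun i => hXh1 (c i)) Finset.univ
          simpa using this
        have hb1 : b =O[𝓝 0] fun x => ‖x‖ ^ 1 := hb.trans (isBigO_pow_le (hm0.trans hm))
        have ht1 : Tendsto (fun x : (Fin s ⊕ κ) → ℂ => ‖x‖ ^ 1) (𝓝 0) (𝓝 0) := by
          simpa using (continuous_norm (E := (Fin s ⊕ κ) → ℂ)).tendsto 0
        have hab : Tendsto (fun x => (a x, b x)) (𝓝 0) (𝓝 (0 : ℂ × ℂ)) :=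
          (ha.trans_tendsto ht1).prodMk_nhds (hb1.trans_tendsto ht1)
        have t2 : (fun x => Λ (a x + b x) - Λ (a x) - b x) =O[𝓝 0] fun x => ‖x‖ ^ (m + 1) := by
          refine (hΛ.comp_tendsto hab).trans ?_
          have := (ha.norm_left.add hb1.norm_left).mul hb.norm_left
          simpa [← pow_add, ← pow_succ', Function.comp_def] using this
        refine (((hR' j).add t1).add t2).congr_left fun x => ?_
        have e1 : a x + b x = MvPolynomial.eval (X x) (gp j - gq j) := by
          simp [a, b, sub_eq_add_neg]
        have e2 : ∑ c, (∏ i, x (c i) - ∏ i, Xh (c i) x) * q c j =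
            ∑ c, (∏ i, x (c i)) * q c j + b x := by
          simp only [b, hev, sub_mul, Finset.sum_sub_distrib]
          rw [sub_eq_add_neg]
          congr 2
          exact Finset.sum_congr rfl fun c _ => mul_comm _ _
        rw [e1, e2]
        simp only [Res, Pi.sub_apply, Matrix.mulVec_add, Pi.add_apply, Finset.sum_apply,
          Pi.smul_apply, smul_eq_mul, a]
        ring
  have hMu : IsUnit M.det := isUnit_iff_ne_zero.2 hM
  obtain ⟨N, hN⟩ := h.solve (LinearMap.toContinuousLinearMap (Matrix.toLin' M))
    (LinearMap.toContinuousLinearMap (Matrix.toLin' M⁻¹)) (fun v => by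
      simp [Matrix.mulVec_mulVec, Matrix.mul_nonsing_inv _ hMu])
  obtain ⟨ϕ, gp, hϕa, hϕm, hgp, hR⟩ := key (max N m0) (le_max_right _ _)
  obtain ⟨χ, hχa, hχm, hχ⟩ := hN (max N m0) (le_max_left _ _) _
    (hRes ϕ gp hϕa fun j n hn => (hgp j n hn).1) hR
  refine ⟨fun x => ϕ x + χ x, gp, hϕa.add hχa,
    hϕm.add (hχm.trans (isBigO_pow_le (le_max_right _ _))), hgp, ?_⟩
  filter_upwards [hχ] with x hx
  simp only [LinearMap.coe_toContinuousLinearMap', Matrix.toLin'_apply, Res] at hx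
  rw [Matrix.mulVec_add]
  rw [eq_sub_iff_add_eq] at hx
  rw [← hx]
  abel

end norml

section core

lemma log_one_add_isBigO : (fun z : ℂ × ℂ => Complex.log (1 + (z.1 + z.2)) - Complex.log (1 + z.1) - z.2)
    =O[𝓝 0] fun z => (‖z.1‖ + ‖z.2‖) * ‖z.2‖ := by
  refine IsBigO.of_bound 2 ?_
  have hc : Tendsto (fun z : ℂ × ℂ => ‖z.1‖ + ‖z.2‖) (𝓝 0) (𝓝 0) := by
    have : Continuous (fun z : ℂ × ℂ => ‖z.1‖ + ‖z.2‖) := by fun_prop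
    simpa using this.tendsto 0
  filter_upwards [hc.eventually (gt_mem_nhds (show (0:ℝ) < 1/2 by norm_num))] with z hz
  set ρ := ‖z.1‖ + ‖z.2‖ with hρ
  have hd : ∀ w ∈ Metric.closedBall (0 : ℂ) ρ,
      HasDerivWithinAt (fun w => Complex.log (1 + w) - w) (1 / (1 + w) - 1) (Metric.closedBall 0 ρ) w := by
    intro w hw
    rw [mem_closedBall_zero_iff] at hw
    have hs : 1 + w ∈ Complex.slitPlane := by
      refine Complex.mem_slitPlane_of_norm_lt_one (by linarith)
    exact ((((hasDerivAt_id w).const_add 1).clog hs).sub (hasDerivAt_id w)).hasDerivWithinAt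
  have hb : ∀ w ∈ Metric.closedBall (0 : ℂ) ρ, ‖1 / (1 + w) - 1‖ ≤ 2 * ρ := by
    intro w hw
    rw [mem_closedBall_zero_iff] at hw
    have h1 : 1 / 2 ≤ ‖1 + w‖ := by
      have := norm_sub_norm_le (1 : ℂ) (-w)
      simp only [norm_one, norm_neg, sub_neg_eq_add] at this
      linarith
    have h2 : 1 + w ≠ 0 := by
      intro h0; rw [h0, norm_zero] at h1; norm_num at h1
    have : 1 / (1 + w) - 1 = -w / (1 + w) := by field_simp; ring
    rw [this, norm_div, norm_neg, div_le_iff₀ (by linarith)]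
    nlinarith [norm_nonneg w]
  have := (convex_closedBall (0 : ℂ) ρ).norm_image_sub_le_of_norm_hasDerivWithin_le hd hb
    (x := z.1) (y := z.1 + z.2)
    (by rw [mem_closedBall_zero_iff, hρ]; linarith [norm_nonneg z.2])
    (by rw [mem_closedBall_zero_iff, hρ]; exact norm_add_le _ _)
  have e : Complex.log (1 + (z.1 + z.2)) - (z.1 + z.2) - (Complex.log (1 + z.1) - z.1) =
    Complex.log (1 + (z.1 + z.2)) - Complex.log (1 + z.1) - z.2 := by ring
  rw [e, add_sub_cancel_left] at this
  rw [norm_mul, norm_norm, Real.norm_of_nonneg (by positivity)]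
  linarith

lemma id_isBigO : (fun z : ℂ × ℂ => (fun w : ℂ => w) (z.1 + z.2) - (fun w : ℂ => w) z.1 - z.2)
    =O[𝓝 0] fun z => (‖z.1‖ + ‖z.2‖) * ‖z.2‖ := by
  refine (Asymptotics.isBigO_zero _ _).congr_left fun z => ?_
  simp

section
variable {E : Type} [NormedAddCommGroup E] [NormedSpace ℂ E]

lemma analytic_log_one_add {g : E → ℂ} (hg : AnalyticAt ℂ g 0) (h0 : g 0 = 0) :
    AnalyticAt ℂ (fun x => Complex.log (1 + g x)) 0 :=
  (analyticAt_const.add hg).clog (by simp [h0])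

lemma eventually_one_add_ne {g : E → ℂ} (hg : AnalyticAt ℂ g 0) (h0 : g 0 = 0) :
    ∀ᶠ x in 𝓝 0, 1 + g x ≠ 0 := by
  have : ContinuousAt (fun x => 1 + g x) 0 := (analyticAt_const.add hg).continuousAt
  exact this.eventually_ne (by simp [h0])

lemma mul_exp_tangent {c ϕ : E → ℂ} (hc : c =O[𝓝 0] fun x => ‖x‖ ^ 1) (hϕ : AnalyticAt ℂ ϕ 0)
    (h0 : ϕ 0 = 0) : (fun x => c x - c x * Complex.exp (ϕ x)) =O[𝓝 0] fun x => ‖x‖ ^ 2 := by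
  have h1 : (fun x => 1 - Complex.exp (ϕ x)) =O[𝓝 0] fun x => ‖x‖ ^ 1 :=
    analytic_isBigO_one (analyticAt_const.sub hϕ.cexp) (by simp [h0])
  have := hc.mul h1
  refine (this.congr_left fun x => by ring).congr_right fun x => by ring
end

lemma prod_pow_lt_one {s : ℕ} {a : Fin s → ℂ} (ha : ∀ l, ‖a l‖ < 1) {n : Fin s →₀ ℕ} (hn : n ≠ 0) :
    ‖∏ l, a l ^ n l‖ < 1 := by
  classical
  obtain ⟨j, hj⟩ : ∃ j, n j ≠ 0 := by
    by_contra! hc; exact hn (Finsupp.ext hc)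
  rw [norm_prod, ← Finset.mul_prod_erase _ _ (Finset.mem_univ j)]
  have h1 : ‖a j ^ n j‖ < 1 := by
    rw [norm_pow]; exact pow_lt_one₀ (norm_nonneg _) (ha j) hj
  have h2 : ∏ l ∈ Finset.univ.erase j, ‖a l ^ n l‖ ≤ 1 := by
    refine Finset.prod_le_one (fun _ _ => norm_nonneg _) fun l _ => ?_
    rw [norm_pow]; exact pow_le_one₀ (norm_nonneg _) (ha l).le
  exact mul_lt_one_of_nonneg_of_lt_one_left (norm_nonneg _) h1 h2

lemma prod_pow_lt {s : ℕ} {a : Fin s → ℂ} (ha : ∀ l, ‖a l‖ < 1) (h0 : ∀ l, a l ≠ 0)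
    {n : Fin s →₀ ℕ} (hn : 2 ≤ n.sum fun _ a => a) {j : Fin s} (hj : n j ≠ 0) :
    ‖∏ l, a l ^ n l‖ < ‖a j‖ := by
  classical
  set n' := n - Finsupp.single j 1 with hn'
  have e : n = Finsupp.single j 1 + n' := by
    rw [hn', add_tsub_cancel_of_le]
    rw [Finsupp.single_le_iff]; omega
  have hn0 : n' ≠ 0 := by
    intro h; rw [h, add_zero] at e; rw [e, Finsupp.sum_single_index rfl] at hn; omega
  have := prod_pow_lt_one ha hn0
  have e2 : ∏ l, a l ^ n l = a j * ∏ l, a l ^ n' l := by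
    have : ∏ l, a l ^ (Finsupp.single j 1 : Fin s →₀ ℕ) l = a j := by
      rw [Finset.prod_eq_single j]
      · simp
      · intro b _ hb; simp [hb.symm]
      · simp
    conv_rhs => rw [← this, ← Finset.prod_mul_distrib]
    refine Finset.prod_congr rfl fun l _ => ?_
    rw [← pow_add, ← Finsupp.add_apply, ← e]
  rw [e2, norm_mul]
  exact mul_lt_of_lt_one_right (norm_pos_iff.2 (h0 j)) this

lemma eval_congr_vars {s : ℕ} {P : MvPolynomial (Fin s) ℂ} {X X' : Fin s → ℂ}
    (h : ∀ n l, MvPolynomial.coeff n P ≠ 0 → n l ≠ 0 → X l = X' l) :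
    MvPolynomial.eval X P = MvPolynomial.eval X' P := by
  rw [MvPolynomial.eval_eq', MvPolynomial.eval_eq']
  refine Finset.sum_congr rfl fun n hn => ?_
  congr 1
  refine Finset.prod_congr rfl fun l _ => ?_
  by_cases hl : n l = 0
  · simp [hl]
  · rw [h n l (MvPolynomial.mem_support_iff.1 hn) hl]

variable {s : ℕ} {κ : Type} [Fintype κ] {F : ((Fin s ⊕ κ) → ℂ) → ((Fin s ⊕ κ) → ℂ)}
  {μ : (Fin s ⊕ κ) → ℂ}

lemma GoodGerm.utype (h : GoodGerm F μ) (hμ0 : ∀ a, μ (Sum.inr a) = 0) (k : Fin s)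
    (θ : ((Fin s ⊕ κ) → ℂ) → ℂ) (hθ : AnalyticAt ℂ θ 0) (hθ0 : θ 0 = 0)
    (hk : ∀ᶠ x in 𝓝 0, F x (Sum.inl k) = μ (Sum.inl k) * x (Sum.inl k) * (1 + θ x)) :
    ∃ ϕ : ((Fin s ⊕ κ) → ℂ) → ℂ, AnalyticAt ℂ ϕ 0 ∧ ϕ 0 = 0 ∧
      ∀ᶠ x in 𝓝 0, F x (Sum.inl k) * Complex.exp (ϕ (F x)) =
        μ (Sum.inl k) * (x (Sum.inl k) * Complex.exp (ϕ x)) := by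
  have hψa : AnalyticAt ℂ (fun x (_ : Fin 1) => -Complex.log (1 + θ x)) 0 :=
    AnalyticAt.pi fun _ => (analytic_log_one_add hθ hθ0).neg
  obtain ⟨ϕ, gp, hϕa, hϕm, hgp, hR⟩ := h.normalize hμ0 (1 : Matrix (Fin 1) (Fin 1) ℂ) (by simp)
    (fun x k => x (Sum.inl k)) (fun k => analytic_coord _)
    (fun k => by simpa using Asymptotics.isBigO_zero _ _) (fun w => w) analyticAt_id rfl
    id_isBigO 1 le_rfl _ hψa (analytic_isBigO_one hψa (by ext; simp [hθ0]))
  have hg0 : ∀ j, gp j = 0 := by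
    intro j
    ext n
    by_contra hne
    obtain ⟨h1, h2⟩ := hgp j n hne
    have hn : n ≠ 0 := by rintro rfl; simp at h1
    have h3 := prod_pow_lt_one (a := fun l => μ (Sum.inl l)) (fun l => h.con _) hn
    simp only [Matrix.det_unique, Matrix.sub_apply, Matrix.smul_apply, Matrix.one_apply_eq,
      smul_eq_mul, mul_one, sub_eq_zero] at h2
    rw [← h2] at h3
    simp at h3
  refine ⟨fun x => ϕ x 0, analyticAt_pi_iff.1 hϕa 0, congrFun (isBigO_zero one_pos hϕm) 0, ?_⟩
  filter_upwards [hR, hk, eventually_one_add_ne hθ hθ0] with x hx hkx hne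
  have h0 := congrFun hx 0
  simp only [Pi.sub_apply, Matrix.one_mulVec, hg0, map_zero, add_zero] at h0
  have h1 : ϕ (F x) 0 = ϕ x 0 - Complex.log (1 + θ x) := by linear_combination h0
  rw [h1, Complex.exp_sub, Complex.exp_log hne, hkx]
  field_simp

lemma GoodGerm.xnorm (h : GoodGerm F μ) (hμ0 : ∀ a, μ (Sum.inr a) = 0)
    (hne : ∀ k, μ (Sum.inl k) ≠ 0) (U : Set (Fin s))
    (Z : ((Fin s ⊕ κ) → ℂ) → Fin s → ℂ) (hZa : ∀ k ∈ U, AnalyticAt ℂ (fun x => Z x k) 0)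
    (hZ : ∀ k ∈ U, (fun x => x (Sum.inl k) - Z x k) =O[𝓝 0] fun x => ‖x‖ ^ 2)
    (hZF : ∀ k ∈ U, ∀ᶠ x in 𝓝 0, Z (F x) k = μ (Sum.inl k) * Z x k) :
    ∃ (X : ((Fin s ⊕ κ) → ℂ) → Fin s → ℂ) (q : Fin s → MvPolynomial (Fin s) ℂ),
      (∀ k, AnalyticAt ℂ (fun x => X x k) 0) ∧
      (∀ k, (fun x => x (Sum.inl k) - X x k) =O[𝓝 0] fun x => ‖x‖ ^ 2) ∧
      (∀ k ∈ U, ∀ x, X x k = Z x k) ∧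
      (∀ k n, MvPolynomial.coeff n (q k) ≠ 0 → 2 ≤ (n.sum fun _ a => a) ∧
        ∏ l, μ (Sum.inl l) ^ n l = μ (Sum.inl k)) ∧
      ∀ k, ∀ᶠ x in 𝓝 0, X (F x) k = μ (Sum.inl k) * X x k + MvPolynomial.eval (X x) (q k) := by
  classical
  let rk (k : Fin s) : ℕ := (Finset.univ.filter fun j => ‖μ (Sum.inl k)‖ < ‖μ (Sum.inl j)‖).card
  have hrk : ∀ k l, ‖μ (Sum.inl k)‖ < ‖μ (Sum.inl l)‖ → rk l < rk k := by
    intro k l hkl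
    refine Finset.card_lt_card ?_
    rw [Finset.ssubset_iff_of_subset]
    · exact ⟨l, by simpa using hkl, by simp⟩
    · intro j hj
      simp only [Finset.mem_filter, Finset.mem_univ, true_and] at hj ⊢
      exact hkl.trans hj
  have hvar : ∀ k (n : Fin s →₀ ℕ) l, 2 ≤ (n.sum fun _ a => a) →
      ∏ l, μ (Sum.inl l) ^ n l = μ (Sum.inl k) → n l ≠ 0 → rk l < rk k := by
    intro k n l h2 hp hl
    refine hrk k l ?_
    rw [← hp]
    exact prod_pow_lt (a := fun l => μ (Sum.inl l)) (fun l => h.con _) hne h2 hl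
  have key : ∀ c : ℕ, ∃ (X : ((Fin s ⊕ κ) → ℂ) → Fin s → ℂ) (q : Fin s → MvPolynomial (Fin s) ℂ),
      (∀ k, AnalyticAt ℂ (fun x => X x k) 0) ∧
      (∀ k, (fun x => x (Sum.inl k) - X x k) =O[𝓝 0] fun x => ‖x‖ ^ 2) ∧
      (∀ k ∈ U, ∀ x, X x k = Z x k) ∧
      (∀ k ∈ U, q k = 0) ∧
      (∀ k n, MvPolynomial.coeff n (q k) ≠ 0 → 2 ≤ (n.sum fun _ a => a) ∧
        ∏ l, μ (Sum.inl l) ^ n l = μ (Sum.inl k)) ∧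
      ∀ k, rk k < c →
        ∀ᶠ x in 𝓝 0, X (F x) k = μ (Sum.inl k) * X x k + MvPolynomial.eval (X x) (q k) := by
    intro c
    induction c with
    | zero =>
      refine ⟨fun x k => if k ∈ U then Z x k else x (Sum.inl k), fun _ => 0, ?_, ?_, ?_, ?_, ?_, ?_⟩
      · intro k
        by_cases hk : k ∈ U
        · simpa only [hk, if_true] using hZa k hk
        · simpa only [hk, if_false] using analytic_coord (Sum.inl k)
      · intro k
        by_cases hk : k ∈ U
        · simpa only [hk, if_true] using hZ k hk
        · simpa only [hk, if_false, sub_self] using Asymptotics.isBigO_zero _ _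
      · intro k hk x; simp [hk]
      · simp
      · simp
      · simp
    | succ c ih =>
      obtain ⟨X, q, hXa, hX, hXU, hqU, hq, hXF⟩ := ih
      have hn : ∀ k, ∃ (ϕ : ((Fin s ⊕ κ) → ℂ) → ℂ) (g : MvPolynomial (Fin s) ℂ),
          AnalyticAt ℂ ϕ 0 ∧ (ϕ =O[𝓝 0] fun x => ‖x‖ ^ 2) ∧
          (∀ n, MvPolynomial.coeff n g ≠ 0 → 2 ≤ (n.sum fun _ a => a) ∧
            ∏ l, μ (Sum.inl l) ^ n l = μ (Sum.inl k)) ∧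
          ∀ᶠ x in 𝓝 0, ϕ (F x) - μ (Sum.inl k) * ϕ x =
            (F x (Sum.inl k) - μ (Sum.inl k) * x (Sum.inl k)) + MvPolynomial.eval (X x) g := by
        intro k
        obtain ⟨ϕ, gp, hϕa, hϕm, hgp, hR⟩ := h.normalize hμ0
          (μ (Sum.inl k) • (1 : Matrix (Fin 1) (Fin 1) ℂ)) (by simpa using hne k)
          X hXa hX (fun w => w) analyticAt_id rfl id_isBigO 2 one_le_two
          (fun x _ => F x (Sum.inl k) - μ (Sum.inl k) * x (Sum.inl k))
          (AnalyticAt.pi fun _ => (h.an_coord _).sub (analyticAt_const.mul (analytic_coord _)))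
          (isBigO_pi.2 fun _ => h.lin _)
        refine ⟨fun x => ϕ x 0, gp 0, analyticAt_pi_iff.1 hϕa 0, isBigO_pi.1 hϕm 0, ?_, ?_⟩
        · intro n hn
          obtain ⟨h1, h2⟩ := hgp 0 n hn
          refine ⟨h1, ?_⟩
          simp only [Matrix.det_unique, Matrix.sub_apply, Matrix.smul_apply, Matrix.one_apply_eq,
            smul_eq_mul, mul_one, sub_eq_zero] at h2
          exact h2.symm
        · filter_upwards [hR] with x hx
          simpa [Matrix.smul_mulVec] using congrFun hx 0
      choose ϕ g hϕa hϕm hg hϕF using hn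
      let X' (x : (Fin s ⊕ κ) → ℂ) (k : Fin s) : ℂ :=
        if k ∈ U ∨ rk k < c then X x k else x (Sum.inl k) - ϕ k x
      let q' (k : Fin s) : MvPolynomial (Fin s) ℂ := if k ∈ U ∨ rk k < c then q k else - g k
      have hq' : ∀ k n, MvPolynomial.coeff n (q' k) ≠ 0 → 2 ≤ (n.sum fun _ a => a) ∧
        ∏ l, μ (Sum.inl l) ^ n l = μ (Sum.inl k) := by
        intro k n hn
        by_cases hk : k ∈ U ∨ rk k < c
        · simp only [q', hk, if_true] at hn; exact hq k n hn
        · simp only [q', hk, if_false, MvPolynomial.coeff_neg, neg_ne_zero] at hn; exact hg k n hn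
      have hev : ∀ k, rk k < c + 1 → ∀ x,
          MvPolynomial.eval (X' x) (q' k) = MvPolynomial.eval (X x) (q' k) := by
        intro k hk x
        refine eval_congr_vars fun n l hn hl => ?_
        have := hvar k n l (hq' k n hn).1 (hq' k n hn).2 hl
        simp only [X']
        rw [if_pos (Or.inr (by omega))]
      refine ⟨X', q', ?_, ?_, ?_, ?_, hq', ?_⟩
      · intro k
        by_cases hk : k ∈ U ∨ rk k < c
        · simpa only [X', hk, if_true] using hXa k
        · simp only [X', hk, if_false]; exact (analytic_coord (Sum.inl k)).sub (hϕa k)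
      · intro k
        by_cases hk : k ∈ U ∨ rk k < c
        · simpa only [X', hk, if_true] using hX k
        · simpa only [X', hk, if_false, sub_sub_cancel] using hϕm k
      · intro k hk x
        simp only [X', hk, true_or, if_true]; exact hXU k hk x
      · intro k hk
        simp only [q', hk, true_or, if_true]; exact hqU k hk
      · intro k hkc
        by_cases hkU : k ∈ U
        · filter_upwards [hZF k hkU] with x hx
          simp only [X', q', hkU, true_or, if_true, hqU k hkU, map_zero, add_zero]
          rw [hXU k hkU, hXU k hkU, hx]
        by_cases hk : rk k < c
        · filter_upwards [hXF k hk] with x hx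
          rw [hev k hkc]
          simpa only [X', q', hk, or_true, if_true] using hx
        · filter_upwards [hϕF k] with x hx
          rw [hev k hkc]
          simp only [X', q', hk, hkU, or_self, if_false, map_neg]
          linear_combination -hx
  obtain ⟨X, q, h1, h2, h3, -, h4, h5⟩ := key (s + 1)
  refine ⟨X, q, h1, h2, h3, h4, fun k => h5 k ?_⟩
  have := Finset.card_le_univ (Finset.univ.filter fun j => ‖μ (Sum.inl k)‖ < ‖μ (Sum.inl j)‖)
  simp only [Fintype.card_fin] at this
  exact Nat.lt_succ_of_le this

theorem GoodGerm.core (h : GoodGerm F μ) (hμ0 : ∀ a, μ (Sum.inr a) = 0)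
    (hne : ∀ k, μ (Sum.inl k) ≠ 0) {r p : ℕ} (e : Fin r → Fin s) (y : Fin p → κ)
    (β : Fin p → ℂ) (C : Matrix (Fin r) (Fin p) ℕ) (D : Matrix (Fin p) (Fin p) ℕ)
    (hD : (D.map (Nat.cast : ℕ → ℂ)).det ≠ 0)
    (θ : Fin r → ((Fin s ⊕ κ) → ℂ) → ℂ) (hθ : ∀ i, AnalyticAt ℂ (θ i) 0) (hθ0 : ∀ i, θ i 0 = 0)
    (g₀ : Fin p → ((Fin s ⊕ κ) → ℂ) → ℂ) (hg₀ : ∀ i, AnalyticAt ℂ (g₀ i) 0)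
    (hg₀0 : ∀ i, g₀ i 0 = 0)
    (hu : ∀ i, ∀ᶠ x in 𝓝 0,
      F x (Sum.inl (e i)) = μ (Sum.inl (e i)) * x (Sum.inl (e i)) * (1 + θ i x))
    (hy : ∀ j, ∀ᶠ x in 𝓝 0, F x (Sum.inr (y j)) = β j * (∏ l, x (Sum.inl (e l)) ^ C l j) *
      (∏ l, x (Sum.inr (y l)) ^ D l j) * (1 + g₀ j x)) :
    ∃ (X : ((Fin s ⊕ κ) → ℂ) → Fin s → ℂ) (Y : ((Fin s ⊕ κ) → ℂ) → Fin p → ℂ)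
      (q : Fin s → MvPolynomial (Fin s) ℂ) (gp : Fin p → MvPolynomial (Fin s) ℂ),
      (∀ k, AnalyticAt ℂ (fun x => X x k) 0) ∧
      (∀ k, (fun x => x (Sum.inl k) - X x k) =O[𝓝 0] fun x => ‖x‖ ^ 2) ∧
      (∀ j, AnalyticAt ℂ (fun x => Y x j) 0) ∧
      (∀ j, (fun x => x (Sum.inr (y j)) - Y x j) =O[𝓝 0] fun x => ‖x‖ ^ 2) ∧
      (∀ k n, MvPolynomial.coeff n (q k) ≠ 0 → 2 ≤ (n.sum fun _ a => a) ∧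
        ∏ l, μ (Sum.inl l) ^ n l = μ (Sum.inl k)) ∧
      (∀ j n, MvPolynomial.coeff n (gp j) ≠ 0 → 1 ≤ (n.sum fun _ a => a) ∧
        (D.map (Nat.cast : ℕ → ℂ) -
          (∏ l, μ (Sum.inl l) ^ n l) • (1 : Matrix (Fin p) (Fin p) ℂ)).det = 0) ∧
      (∀ k, ∀ᶠ x in 𝓝 0, X (F x) k = μ (Sum.inl k) * X x k + MvPolynomial.eval (X x) (q k)) ∧
      (∀ j, ∀ᶠ x in 𝓝 0, Y (F x) j = β j * (∏ l, X x (e l) ^ C l j) * (∏ l, Y x l ^ D l j) *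
        (1 + MvPolynomial.eval (X x) (gp j))) := by
  classical
  have hUe : ∀ k, ∃ ϕ : ((Fin s ⊕ κ) → ℂ) → ℂ, k ∈ Set.range e → (AnalyticAt ℂ ϕ 0 ∧ ϕ 0 = 0 ∧
      ∀ᶠ x in 𝓝 0, F x (Sum.inl k) * Complex.exp (ϕ (F x)) =
        μ (Sum.inl k) * (x (Sum.inl k) * Complex.exp (ϕ x))) := by
    intro k
    by_cases hk : k ∈ Set.range e
    · obtain ⟨i, rfl⟩ := hk
      obtain ⟨ϕ, hϕ⟩ := h.utype hμ0 (e i) (θ i) (hθ i) (hθ0 i) (hu i)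
      exact ⟨ϕ, fun _ => hϕ⟩
    · exact ⟨0, fun hk' => absurd hk' hk⟩
  choose ϕ hϕ using hUe
  have hϕa : ∀ i, AnalyticAt ℂ (ϕ (e i)) 0 := fun i => (hϕ _ ⟨i, rfl⟩).1
  have hϕ0 : ∀ i, ϕ (e i) 0 = 0 := fun i => (hϕ _ ⟨i, rfl⟩).2.1
  obtain ⟨X, q, hXa, hX, hXZ, hq, hXF⟩ := h.xnorm hμ0 hne (Set.range e)
    (fun x k => x (Sum.inl k) * Complex.exp (ϕ k x))
    (fun k hk => (analytic_coord _).mul (hϕ k hk).1.cexp)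
    (fun k hk => mul_exp_tangent (_root_.coord_isBigO _) (hϕ k hk).1 (hϕ k hk).2.1)
    (fun k hk => (hϕ k hk).2.2)
  have hX0 : X 0 = 0 := by
    ext k; have := isBigO_zero two_pos (hX k); simpa using this
  set DC := D.map (Nat.cast : ℕ → ℂ) with hDC
  have hψa : AnalyticAt ℂ (fun x (j : Fin p) =>
      ∑ l, (C l j : ℂ) * ϕ (e l) x - Complex.log (1 + g₀ j x)) 0 := by
    refine AnalyticAt.pi fun j => AnalyticAt.sub ?_ (analytic_log_one_add (hg₀ j) (hg₀0 j))
    exact Finset.analyticAt_fun_sum _ fun l _ => analyticAt_const.mul (hϕa l)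
  obtain ⟨η, gp, hηa, hηm, hgp, hR⟩ := h.normalize hμ0 DC.transpose
    (by rwa [Matrix.det_transpose]) X hXa hX (fun w => Complex.log (1 + w))
    (analytic_log_one_add analyticAt_id rfl) (by simp) log_one_add_isBigO 1 le_rfl _ hψa
    (analytic_isBigO_one hψa (by ext j; simp [hϕ0, hg₀0]))
  have hηa' : ∀ j, AnalyticAt ℂ (fun x => η x j) 0 := fun j => analyticAt_pi_iff.1 hηa j
  have hη0 : ∀ j, η 0 j = 0 := fun j => by rw [isBigO_zero one_pos hηm]; rfl
  have hg0 : ∀ j, MvPolynomial.eval (X 0) (gp j) = 0 := by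
    intro j
    rw [hX0, MvPolynomial.eval_zero, MvPolynomial.constantCoeff_eq]
    by_contra hne
    have := (hgp j 0 hne).1
    simp at this
  refine ⟨X, fun x j => x (Sum.inr (y j)) * Complex.exp (η x j), q, gp, hXa, hX, ?_, ?_, hq, ?_, hXF, ?_⟩
  · exact fun j => (analytic_coord _).mul (hηa' j).cexp
  · exact fun j => mul_exp_tangent (_root_.coord_isBigO _) (hηa' j) (hη0 j)
  · intro j n hn
    refine ⟨(hgp j n hn).1, ?_⟩
    rw [← Matrix.det_transpose, Matrix.transpose_sub, Matrix.transpose_smul, Matrix.transpose_one]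
    exact (hgp j n hn).2
  · intro j
    filter_upwards [hR, hy j, eventually_one_add_ne (hg₀ j) (hg₀0 j),
      eventually_one_add_ne (analytic_eval hXa (gp j)) (hg0 j)] with x hx hyx hne1 hne2
    have h0 := congrFun hx j
    simp only [Pi.sub_apply, Matrix.mulVec, dotProduct, Matrix.transpose_apply, hDC,
      Matrix.map_apply] at h0
    have h1 : η (F x) j = ∑ l, (D l j : ℂ) * η x l + ∑ l, (C l j : ℂ) * ϕ (e l) x -
        Complex.log (1 + g₀ j x) + Complex.log (1 + MvPolynomial.eval (X x) (gp j)) := by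
      linear_combination h0
    have hXe : ∀ l, X x (e l) = x (Sum.inl (e l)) * Complex.exp (ϕ (e l) x) := fun l =>
      hXZ _ ⟨l, rfl⟩ x
    rw [h1, Complex.exp_add, Complex.exp_sub, Complex.exp_add, Complex.exp_log hne1,
      Complex.exp_log hne2, hyx, Complex.exp_sum, Complex.exp_sum]
    simp only [hXe, mul_pow, Finset.prod_mul_distrib, Complex.exp_nat_mul]
    field_simp

end core

section linalg

lemma exists_basis_of_dual {V J : Type} [AddCommGroup V] [Module ℂ V] [FiniteDimensional ℂ V]
    [Fintype J] (B : Module.Basis J ℂ (Module.Dual ℂ V)) :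
    ∃ v : Module.Basis J ℂ V, ∀ x j, v.repr x j = B j x := by
  let T : V →ₗ[ℂ] (J → ℂ) := LinearMap.pi fun j => B j
  have hT : Function.Injective T := by
    rw [injective_iff_map_eq_zero]
    intro x hx
    rw [← Module.forall_dual_apply_eq_zero_iff ℂ]
    intro φ
    have : ∀ j, B j x = 0 := fun j => congrFun hx j
    rw [← B.sum_repr φ, LinearMap.sum_apply]
    exact Finset.sum_eq_zero fun j _ => by rw [LinearMap.smul_apply, this, smul_zero]
  have hfr : Module.finrank ℂ V = Module.finrank ℂ (J → ℂ) := by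
    rw [Module.finrank_fintype_fun_eq_card, ← Subspace.dual_finrank_eq,
      Module.finrank_eq_card_basis B]
  refine ⟨Module.Basis.ofEquivFun (LinearMap.linearEquivOfInjective T hT hfr), fun x j => ?_⟩
  rw [Module.Basis.ofEquivFun_repr_apply]
  rfl

lemma charpoly_of_coords {V J : Type} [AddCommGroup V] [Module ℂ V] [FiniteDimensional ℂ V]
    [Fintype J] (v : Module.Basis J ℂ V) (A : V →ₗ[ℂ] V) (ν : J → ℂ)
    (h : ∀ x j, v.repr (A x) j = ν j * v.repr x j) :
    A.charpoly = ∏ j, (X - Polynomial.C (ν j)) := by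
  classical
  rw [← LinearMap.charpoly_toMatrix A v]
  have : LinearMap.toMatrix v v A = Matrix.diagonal ν := by
    ext i j
    rw [LinearMap.toMatrix_apply, h, Matrix.diagonal_apply]
    simp only [Module.Basis.repr_self, Finsupp.single_apply]
    by_cases hij : i = j
    · simp [hij]
    · simp [hij, Ne.symm hij]
  rw [this, Matrix.charpoly_diagonal]

lemma fiber_card {J : Type} [Fintype J] {s m : ℕ} (ν : J → ℂ) (lam : Fin s → ℂ)
    (h : ∏ j, (X - Polynomial.C (ν j)) = X ^ m * ∏ i, (X - Polynomial.C (lam i)))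
    (c : ℂ) (hc : c ≠ 0) : Nat.card {j // ν j = c} = Nat.card {k // lam k = c} := by
  classical
  have hr : ∀ {I : Type} [Fintype I] (f : I → ℂ),
      (∏ j, (X - Polynomial.C (f j))).roots = Multiset.map f Finset.univ.val := by
    intro I _ f
    have := Polynomial.roots_multiset_prod_X_sub_C (Multiset.map f Finset.univ.val)
    rw [Multiset.map_map] at this
    exact this
  have hcnt : ∀ {I : Type} [Fintype I] (f : I → ℂ),
      Multiset.count c (Multiset.map f Finset.univ.val) = Nat.card {j // f j = c} := by
    intro I _ f
    rw [Multiset.count_map, Nat.card_eq_fintype_card, Fintype.card_subtype]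
    simp only [eq_comm (a := c)]
    rfl
  have hp0 : (∏ i, (X - Polynomial.C (lam i))) ≠ 0 :=
    Finset.prod_ne_zero_iff.2 fun i _ => Polynomial.X_sub_C_ne_zero _
  have h1 := congrArg Polynomial.roots h
  rw [hr, Polynomial.roots_mul (mul_ne_zero (pow_ne_zero _ Polynomial.X_ne_zero) hp0), hr,
    Polynomial.roots_X_pow] at h1
  have h2 := congrArg (Multiset.count c) h1
  rw [Multiset.count_add, hcnt, hcnt, Multiset.count_nsmul, Multiset.count_singleton, if_neg hc,
    mul_zero, zero_add] at h2
  exact h2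

theorem lin_alg {V : Type} [AddCommGroup V] [Module ℂ V] [FiniteDimensional ℂ V] {d r p s m : ℕ}
    (hdim : Module.finrank ℂ V = d) (A : V →ₗ[ℂ] V)
    (u : Fin r → Module.Dual ℂ V) (yv : Fin p → Module.Dual ℂ V)
    (hind : LinearIndependent ℂ (Sum.elim u yv)) (α : Fin r → ℂ) (hα : ∀ i, α i ≠ 0)
    (hu : ∀ i x, u i (A x) = α i * u i x) (hy : ∀ j x, yv j (A x) = 0)
    {I : Type} [Fintype I] (b : Module.Basis I ℂ V) (c : I → ℂ) (hb : ∀ i, A (b i) = c i • b i)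
    (lam : Fin s → ℂ) (hlam : ∀ i, lam i ≠ 0)
    (hchar : A.charpoly = X ^ m * ∏ i, (X - Polynomial.C (lam i))) :
    ∃ (v : Module.Basis (Fin s ⊕ Fin p ⊕ Fin (d - (s + p))) ℂ V) (e : Fin r → Fin s),
      (∀ i x, v.repr x (Sum.inl (e i)) = u i x) ∧
      (∀ i, lam (e i) = α i) ∧
      (∀ j x, v.repr x (Sum.inr (Sum.inl j)) = yv j x) ∧
      (∀ k x, v.repr (A x) (Sum.inl k) = lam k * v.repr x (Sum.inl k)) ∧
      (∀ a x, v.repr (A x) (Sum.inr a) = 0) := by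
  classical
  have hs : LinearIndepOn ℂ id (Set.range (Sum.elim u yv)) := hind.linearIndepOn_id
  have hbc : ∀ i x, b.coord i (A x) = c i * b.coord i x := by
    intro i x
    have : (b.coord i) ∘ₗ A = c i • b.coord i := by
      refine b.ext fun l => ?_
      by_cases hl : l = i
      · subst hl; simp [hb]
      · simp [hb, hl]
    exact congrArg (fun φ : V →ₗ[ℂ] ℂ => φ x) this
  have hst : Set.range (Sum.elim u yv) ⊆ Set.range (Sum.elim u yv) ∪ Set.range b.coord :=
    Set.subset_union_left
  have ht : ⊤ ≤ Submodule.span ℂ (Set.range (Sum.elim u yv) ∪ Set.range b.coord) := by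
    have h1 := b.dualBasis.span_eq
    rw [← h1]
    refine Submodule.span_mono ?_
    rw [Module.Basis.coe_dualBasis]
    exact Set.subset_union_right
  let J := hs.extend hst
  let B : Module.Basis J ℂ (Module.Dual ℂ V) := Module.Basis.extendLe hs hst ht
  have hBx : ∀ j : J, B j = (j : Module.Dual ℂ V) := Module.Basis.extendLe_apply_self hs hst ht
  have : Fintype J := Module.Basis.fintypeIndexOfRankLtAleph0 B (Module.rank_lt_aleph0 _ _)
  have hν : ∀ j : J, ∃ ν : ℂ, ∀ x, B j (A x) = ν * B j x := by
    intro j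
    rw [hBx]
    rcases hs.extend_subset hst j.2 with ⟨i | i, hi⟩ | ⟨i, hi⟩
    · rw [← hi]; exact ⟨α i, hu i⟩
    · rw [← hi]; exact ⟨0, fun x => by simpa using hy i x⟩
    · rw [← hi]; exact ⟨c i, hbc i⟩
  choose ν hν using hν
  obtain ⟨v, hv⟩ := exists_basis_of_dual B
  have hch := charpoly_of_coords v A ν (fun x j => by rw [hv, hv, hν])
  rw [hch] at hchar
  have hmem : ∀ i, Sum.elim u yv i ∈ J := fun i => hs.subset_extend hst ⟨i, rfl⟩
  have hνeq : ∀ (j : J) (a : ℂ), (∀ x, (j : Module.Dual ℂ V) (A x) = a * (j : Module.Dual ℂ V) x) →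
      ν j = a := by
    intro j a ha
    have h0 := B.ne_zero j
    obtain ⟨x, hx⟩ : ∃ x, B j x ≠ 0 := by
      by_contra! hc; exact h0 (LinearMap.ext hc)
    have h1 := ha x
    rw [← hBx, hν] at h1
    exact mul_right_cancel₀ hx h1
  have hνu : ∀ i, ν ⟨u i, hmem (Sum.inl i)⟩ = α i := fun i => hνeq _ _ (hu i)
  have hνy : ∀ i, ν ⟨yv i, hmem (Sum.inr i)⟩ = 0 := fun i => hνeq _ _ (fun x => by simpa using hy i x)
  -- nonzero part
  have hcard : ∀ z : ℂ, Nat.card {k // lam k = z} = Nat.card {j : {j // ν j ≠ 0} // ν j.1 = z} := by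
    intro z
    by_cases hz : z = 0
    · subst hz
      have : IsEmpty {k // lam k = 0} := ⟨fun k => hlam _ k.2⟩
      have : IsEmpty {j : {j // ν j ≠ 0} // ν j.1 = 0} := ⟨fun k => k.1.2 k.2⟩
      simp
    · rw [← fiber_card ν lam hchar z hz]
      refine Nat.card_congr ⟨fun j => ⟨⟨j.1, by rw [j.2]; exact hz⟩, j.2⟩, fun j => ⟨j.1.1, j.2⟩,
        fun _ => rfl, fun _ => rfl⟩
  let e1 : Fin s ≃ {j // ν j ≠ 0} := Equiv.ofFiberEquiv (f := lam)
    (g := fun j : {j // ν j ≠ 0} => ν j.1) fun z => Classical.choice (Finite.card_eq.1 (hcard z))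
  have he1 : ∀ k, ν (e1 k).1 = lam k := fun k => Equiv.ofFiberEquiv_map (f := lam) (g := fun j : {j // ν j ≠ 0} => ν j.1) _ k
  let J3 := {j : J // ν j = 0 ∧ ∀ i, yv i ≠ (j : Module.Dual ℂ V)}
  let idx : Fin s ⊕ Fin p ⊕ J3 → J := Sum.elim (fun k => (e1 k).1)
    (Sum.elim (fun i => ⟨yv i, hmem (Sum.inr i)⟩) fun j => j.1)
  have hyinj : Function.Injective yv := fun i i' h => by
    have := hind.injective (a₁ := Sum.inr i) (a₂ := Sum.inr i') h
    simpa using this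
  have hidx : Function.Bijective idx := by
    constructor
    · rintro (k | i | j) (k' | i' | j') hh <;> simp only [idx, Sum.elim_inl, Sum.elim_inr] at hh
      · rw [e1.injective (Subtype.ext hh)]
      · exact absurd (by rw [hh]; exact hνy _) (e1 k).2
      · exact absurd (by rw [hh]; exact j'.2.1) (e1 k).2
      · exact absurd (by rw [← hh]; exact hνy _) (e1 k').2
      · rw [hyinj (Subtype.ext_iff.1 hh)]
      · exact absurd (Subtype.ext_iff.1 hh) (j'.2.2 i)
      · exact absurd (by rw [← hh]; exact j.2.1) (e1 k').2
      · exact absurd (Subtype.ext_iff.1 hh).symm (j.2.2 i')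
      · rw [Subtype.ext hh]
    · intro j
      by_cases h0 : ν j = 0
      · by_cases h1 : ∃ i, yv i = (j : Module.Dual ℂ V)
        · obtain ⟨i, hi⟩ := h1
          exact ⟨Sum.inr (Sum.inl i), Subtype.ext hi⟩
        · push Not at h1
          exact ⟨Sum.inr (Sum.inr ⟨j, h0, h1⟩), rfl⟩
      · exact ⟨Sum.inl (e1.symm ⟨j, h0⟩), by simp [idx]⟩
  have hJ : Nat.card J = d := by
    rw [← hdim, Module.finrank_eq_nat_card_basis v]
  have hJ3 : Nat.card J3 = d - (s + p) := by
    have := Nat.card_congr (Equiv.ofBijective idx hidx)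
    rw [Nat.card_sum, Nat.card_sum, hJ] at this
    simp only [Nat.card_eq_fintype_card, Fintype.card_fin] at this ⊢
    omega
  let e3 : Fin (d - (s + p)) ≃ J3 := (finCongr hJ3.symm).trans (Finite.equivFin J3).symm
  let ee : Fin s ⊕ Fin p ⊕ Fin (d - (s + p)) ≃ J :=
    (Equiv.sumCongr (Equiv.refl _) (Equiv.sumCongr (Equiv.refl _) e3)).trans
      (Equiv.ofBijective idx hidx)
  have hrep : ∀ x i, (v.reindex ee.symm).repr x i = B (ee i) x := by
    intro x i
    rw [Module.Basis.repr_reindex_apply, hv, Equiv.symm_symm]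
  have heel : ∀ k, ee (Sum.inl k) = (e1 k).1 := fun k => rfl
  refine ⟨v.reindex ee.symm, fun i => e1.symm ⟨⟨u i, hmem (Sum.inl i)⟩, by rw [hνu]; exact hα i⟩,
    ?_, ?_, ?_, ?_, ?_⟩
  · intro i x
    rw [hrep, heel, Equiv.apply_symm_apply, hBx]
  · intro i
    rw [← he1, Equiv.apply_symm_apply, hνu]
  · intro j x
    rw [hrep, hBx]; rfl
  · intro k x
    rw [hrep, hrep, hν, heel, he1]
  · intro a x
    rw [hrep, hν]
    have : ν (ee (Sum.inr a)) = 0 := by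
      rcases a with j | a
      · exact hνy j
      · exact (e3 a).2.1
    rw [this, zero_mul]

end linalg

section final

lemma analytic_isBigO_two {E V : Type} [NormedAddCommGroup E] [NormedSpace ℂ E]
    [NormedAddCommGroup V] [NormedSpace ℂ V] {f : E → V} (hf : AnalyticAt ℂ f 0) (h0 : f 0 = 0)
    (h1 : HasFDerivAt f (0 : E →L[ℂ] V) 0) :
    f =O[𝓝 0] fun x => ‖x‖ ^ 2 := by
  obtain ⟨P, hP⟩ := hf
  have := hP.isBigO_sub_partialSum_pow 2
  refine this.congr_left fun y => ?_
  have h2 : P 0 (fun _ => y) = 0 := by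
    rw [hP.coeff_zero, h0]
  have h3 : P 1 (fun _ => y) = 0 := by
    have := hP.hasFDerivAt.unique h1
    have := congrArg (fun T : E →L[ℂ] V => T y) this
    rw [continuousMultilinearCurryFin1_apply] at this
    rw [show (fun _ : Fin 1 => y) = Fin.snoc 0 y by ext i; rw [Subsingleton.elim i (Fin.last 0)]; simp]
    exact this
  simp [FormalMultilinearSeries.partialSum, Finset.sum_range_succ, h2, h3]

lemma hasFDerivAt_zero_of_isBigO {E V : Type} [NormedAddCommGroup E] [NormedSpace ℂ E]
    [NormedAddCommGroup V] [NormedSpace ℂ V] {f : E → V} (h : f =O[𝓝 0] fun x => ‖x‖ ^ 2) :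
    HasFDerivAt f (0 : E →L[ℂ] V) 0 :=
  Asymptotics.IsBigO.hasFDerivAt (n := 2) (by simpa using h) one_lt_two

lemma hasFDerivAt_of_isBigO {E V : Type} [NormedAddCommGroup E] [NormedSpace ℂ E]
    [NormedAddCommGroup V] [NormedSpace ℂ V] {f : E → V} (T : E →L[ℂ] V)
    (h : (fun x => T x - f x) =O[𝓝 0] fun x => ‖x‖ ^ 2) :
    HasFDerivAt f T 0 := by
  have h1 := (T.hasFDerivAt (x := 0)).sub (hasFDerivAt_zero_of_isBigO h)
  refine (h1.congr_fderiv (by simp)).congr_of_eventuallyEq (Eventually.of_forall fun x => ?_)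
  simp

lemma exists_analytic_inverse {E V : Type} [NormedAddCommGroup E] [NormedSpace ℂ E]
    [NormedAddCommGroup V] [NormedSpace ℂ V] [CompleteSpace E] [CompleteSpace V]
    {f : E → V} (hf : AnalyticAt ℂ f 0) (h0 : f 0 = 0)
    (L : E ≃L[ℂ] V) (hL : HasFDerivAt f (L : E →L[ℂ] V) 0) :
    ∃ g : V → E, AnalyticAt ℂ g 0 ∧ g 0 = 0 ∧ ∀ᶠ x in 𝓝 0, g (f x) = x := by
  have hc : ContDiffAt ℂ ⊤ f 0 := hf.contDiffAt
  have hs := hc.hasStrictFDerivAt' hL (by simp)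
  have h1 := hs.eventually_left_inverse
  refine ⟨hc.localInverse hL (by simp), ?_, ?_, h1⟩
  · have := hc.to_localInverse hL (by simp)
    rw [h0] at this
    exact this.analyticAt
  · have := h1.self_of_nhds
    rw [h0] at this
    exact this

/-- splitting of coordinates -/
def splitL (s p q : ℕ) : ((Fin s ⊕ Fin p ⊕ Fin q) → ℂ) ≃L[ℂ]
    ((Fin s → ℂ) × (Fin p → ℂ) × (Fin q → ℂ)) :=
  LinearEquiv.toContinuousLinearEquiv
  { toFun := fun x => (fun k => x (Sum.inl k), fun j => x (Sum.inr (Sum.inl j)),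
      fun a => x (Sum.inr (Sum.inr a)))
    invFun := fun w => Sum.elim w.1 (Sum.elim w.2.1 w.2.2)
    map_add' := fun _ _ => rfl
    map_smul' := fun _ _ => rfl
    left_inv := fun x => by ext (k | j | a) <;> rfl
    right_inv := fun x => rfl }

lemma splitL_apply {s p q : ℕ} (x : (Fin s ⊕ Fin p ⊕ Fin q) → ℂ) :
    splitL s p q x = (fun k => x (Sum.inl k), fun j => x (Sum.inr (Sum.inl j)),
      fun a => x (Sum.inr (Sum.inr a))) := rfl

lemma prod_pow_isBigO {E : Type} [NormedAddCommGroup E] {r : ℕ} (c : Fin r → E → ℂ)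
    (hc : ∀ l, c l =O[𝓝 0] fun x => ‖x‖ ^ 1) (m : Fin r → ℕ) :
    (fun x => ∏ l, c l x ^ m l) =O[𝓝 0] fun x => ‖x‖ ^ (∑ l, m l) := by
  have h : (fun x => ∏ l, c l x ^ m l) =O[𝓝 0] fun x => ∏ l, ‖x‖ ^ m l := by
    refine IsBigO.finsetProd fun l _ => ?_
    simpa using (hc l).pow (m l)
  refine h.congr_right fun x => Finset.prod_pow_eq_pow_sum _ _ _

lemma prod_E {r s p : ℕ} (e : Fin r → Fin s) (C : Matrix (Fin r) (Fin p) ℕ) (X : Fin s → ℂ)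
    (j : Fin p) : ∏ k, X k ^ (∑ l, if e l = k then C l j else 0) = ∏ l, X (e l) ^ C l j := by
  simp only [← Finset.prod_pow_eq_pow_sum]
  rw [Finset.prod_comm]
  refine Finset.prod_congr rfl fun l _ => ?_
  rw [Finset.prod_eq_single (e l)]
  · simp
  · intro b _ hb; simp [hb.symm]
  · simp

/-- Conclusion in good coordinates. -/
theorem GoodGerm.conclude {s p q r : ℕ}
    {F : ((Fin s ⊕ Fin p ⊕ Fin q) → ℂ) → ((Fin s ⊕ Fin p ⊕ Fin q) → ℂ)}
    {μ : (Fin s ⊕ Fin p ⊕ Fin q) → ℂ} (h : GoodGerm F μ) (hμ0 : ∀ a, μ (Sum.inr a) = 0)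
    (hne : ∀ k, μ (Sum.inl k) ≠ 0) (e : Fin r → Fin s)
    (β : Fin p → ℂ) (C : Matrix (Fin r) (Fin p) ℕ) (D : Matrix (Fin p) (Fin p) ℕ)
    (hD : (D.map (Nat.cast : ℕ → ℂ)).det ≠ 0)
    (θ : Fin r → ((Fin s ⊕ Fin p ⊕ Fin q) → ℂ) → ℂ) (hθ : ∀ i, AnalyticAt ℂ (θ i) 0)
    (hθ0 : ∀ i, θ i 0 = 0)
    (g₀ : Fin p → ((Fin s ⊕ Fin p ⊕ Fin q) → ℂ) → ℂ) (hg₀ : ∀ i, AnalyticAt ℂ (g₀ i) 0)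
    (hg₀0 : ∀ i, g₀ i 0 = 0)
    (hu : ∀ i, ∀ᶠ x in 𝓝 0,
      F x (Sum.inl (e i)) = μ (Sum.inl (e i)) * x (Sum.inl (e i)) * (1 + θ i x))
    (hy : ∀ j, ∀ᶠ x in 𝓝 0, F x (Sum.inr (Sum.inl j)) = β j * (∏ l, x (Sum.inl (e l)) ^ C l j) *
      (∏ l, x (Sum.inr (Sum.inl l)) ^ D l j) * (1 + g₀ j x)) :
    ∃ (E : Matrix (Fin s) (Fin p) ℕ)
      (σp : Fin s → MvPolynomial (Fin s) ℂ) (gp : Fin p → MvPolynomial (Fin s) ℂ)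
      (hh : ((Fin s → ℂ) × (Fin p → ℂ) × (Fin q → ℂ)) → Fin q → ℂ),
      (∀ (kk : Fin s) (n : Fin s →₀ ℕ), MvPolynomial.coeff n (σp kk) ≠ 0 →
        n = Finsupp.single kk 1 ∨
          (2 ≤ (n.sum fun _ a => a) ∧ (∏ i, μ (Sum.inl i) ^ n i) = μ (Sum.inl kk))) ∧
      (∀ kk : Fin s, MvPolynomial.coeff (Finsupp.single kk 1) (σp kk) = μ (Sum.inl kk)) ∧
      (∀ i : Fin p, MvPolynomial.coeff 0 (gp i) = 0) ∧
      (∀ (i : Fin p) (n : Fin s →₀ ℕ), MvPolynomial.coeff n (gp i) ≠ 0 →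
        ((D.map (Nat.cast : ℕ → ℂ))
            - (∏ l, μ (Sum.inl l) ^ n l) • (1 : Matrix (Fin p) (Fin p) ℂ)).det = 0) ∧
      AnalyticAt ℂ hh 0 ∧ hh 0 = 0 ∧ fderiv ℂ hh 0 = 0 ∧
      ∃ (Ψ : ((Fin s ⊕ Fin p ⊕ Fin q) → ℂ) → ((Fin s → ℂ) × (Fin p → ℂ) × (Fin q → ℂ))),
        AnalyticAt ℂ Ψ 0 ∧ Ψ 0 = 0 ∧
        HasFDerivAt Ψ (splitL s p q : ((Fin s ⊕ Fin p ⊕ Fin q) → ℂ) →L[ℂ] _) 0 ∧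
        ∀ᶠ x in 𝓝 0, Ψ (F x) =
          (fun w : ((Fin s → ℂ) × (Fin p → ℂ) × (Fin q → ℂ)) =>
            ((fun kk => MvPolynomial.eval w.1 (σp kk)),
             (fun i => β i * (∏ l, w.1 l ^ E l i) * (∏ l, w.2.1 l ^ D l i)
                 * (1 + MvPolynomial.eval w.1 (gp i))),
             hh w)) (Ψ x) := by
  classical
  obtain ⟨X, Y, Q, gp, hXa, hX, hYa, hY, hQ, hgp, hXF, hYF⟩ := h.core hμ0 hne e Sum.inl β C D hD
    θ hθ hθ0 g₀ hg₀ hg₀0 hu hy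
  let Ψ (x : (Fin s ⊕ Fin p ⊕ Fin q) → ℂ) : ((Fin s → ℂ) × (Fin p → ℂ) × (Fin q → ℂ)) :=
    (X x, Y x, fun a => x (Sum.inr (Sum.inr a)))
  have hΨa : AnalyticAt ℂ Ψ 0 := by
    refine AnalyticAt.prod (AnalyticAt.pi hXa) (AnalyticAt.prod (AnalyticAt.pi hYa) ?_)
    exact AnalyticAt.pi fun a => analytic_coord _
  have hΨ0 : Ψ 0 = 0 := by
    have h1 : X 0 = 0 := by
      ext k; have := isBigO_zero two_pos (hX k); simpa using this
    have h2 : Y 0 = 0 := by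
      ext k; have := isBigO_zero two_pos (hY k); simpa using this
    simp only [Ψ, h1, h2]; rfl
  have hΨd : HasFDerivAt Ψ (splitL s p q : ((Fin s ⊕ Fin p ⊕ Fin q) → ℂ) →L[ℂ] _) 0 := by
    refine hasFDerivAt_of_isBigO _ ?_
    refine IsBigO.prod_left (f' := fun x => (fun k => x (Sum.inl k)) - X x) (isBigO_pi.2 hX) ?_
    refine IsBigO.prod_left (f' := fun x => (fun k => x (Sum.inr (Sum.inl k))) - Y x)
      (g' := fun x => (fun a => x (Sum.inr (Sum.inr a))) - fun a => x (Sum.inr (Sum.inr a)))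
      (isBigO_pi.2 hY) ?_
    refine (Asymptotics.isBigO_zero _ _).congr_left fun x => ?_
    rw [sub_self]
  obtain ⟨G, hGa, hG0, hG⟩ := exists_analytic_inverse hΨa hΨ0 (splitL s p q) hΨd
  have hGt : Tendsto G (𝓝 0) (𝓝 0) := by
    have := hGa.continuousAt.tendsto
    rwa [hG0] at this
  let hh (w : (Fin s → ℂ) × (Fin p → ℂ) × (Fin q → ℂ)) : Fin q → ℂ :=
    fun a => F (G w) (Sum.inr (Sum.inr a))
  have hhO : hh =O[𝓝 0] fun w => ‖w‖ ^ 2 := by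
    refine isBigO_pi.2 fun a => ?_
    have h1 := (h.lin (Sum.inr (Sum.inr a))).comp_tendsto hGt
    simp only [hμ0, zero_mul, sub_zero, Function.comp_def] at h1
    refine h1.trans ?_
    have := (analytic_isBigO_one hGa hG0).norm_left.pow 2
    simpa using this
  refine ⟨fun k j => ∑ l, if e l = k then C l j else 0,
    fun k => MvPolynomial.C (μ (Sum.inl k)) * MvPolynomial.X k + Q k, gp, hh, ?_, ?_, ?_, ?_, ?_, ?_,
    ?_, Ψ, hΨa, hΨ0, hΨd, ?_⟩
  · intro k n hn
    by_cases hq : MvPolynomial.coeff n (Q k) = 0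
    · left
      rw [MvPolynomial.coeff_add, hq, add_zero, MvPolynomial.coeff_C_mul, MvPolynomial.coeff_X] at hn
      by_contra hc
      exact hn (by rw [if_neg (Ne.symm hc), mul_zero])
    · exact Or.inr (hQ k n hq)
  · intro k
    have : MvPolynomial.coeff (Finsupp.single k 1) (Q k) = 0 := by
      by_contra hc
      have := (hQ k _ hc).1
      rw [Finsupp.sum_single_index rfl] at this
      omega
    simp [this]
  · intro j
    by_contra hc
    have := (hgp j 0 hc).1
    simp at this
  · exact fun j n hn => (hgp j n hn).2
  · refine AnalyticAt.pi fun a => ?_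
    have := h.an_coord (Sum.inr (Sum.inr a))
    rw [← hG0] at this
    exact this.comp hGa
  · exact isBigO_zero two_pos hhO
  · exact (hasFDerivAt_zero_of_isBigO hhO).fderiv
  · filter_upwards [eventually_all.2 hXF, eventually_all.2 hYF, hG] with x h1 h2 h3
    refine Prod.ext ?_ (Prod.ext ?_ ?_)
    · ext k
      simp only [Ψ, h1 k, map_add, map_mul, MvPolynomial.eval_C, MvPolynomial.eval_X]
    · ext j
      simp only [Ψ, h2 j, prod_E]
    · ext a
      simp only [hh, h3]
      rfl

end final

end Aux

/-- Main theorem (fixed periodic components, vanishing nilpotent part):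
a contracting holomorphic germ of the form
`f(u,y,w) = (α u (1+θ), β u^C y^D (1+g₀), k)` with `det D ≠ 0`, every column
of `(C, D)` of total size `≥ 2`, and `df₀` diagonalizable, is holomorphically
conjugated to `(x,y,z) ↦ (σ(x), β' x^E y^D (1+g(x)), h(x,y,z))` where `σ` is a
polynomial in Poincaré–Dulac normal form, `g` is a polynomial whose monomials
are all secondary resonant (`λ^n` an eigenvalue of `D`), and `dh₀ = 0`. Here
`s` counts the nonzero eigenvalues `λ` of `df₀` with multiplicity, as encoded
by the characteristic polynomial. -/
theorem stmt_0 (r p t s : ℕ)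
    (f : Sp r p t → Sp r p t)
    (α : Fin r → ℂ) (β : Fin p → ℂ)
    (C : Matrix (Fin r) (Fin p) ℕ) (D : Matrix (Fin p) (Fin p) ℕ)
    (θ : Sp r p t → Fin r → ℂ) (g₀ : Sp r p t → Fin p → ℂ) (k : Sp r p t → Fin t → ℂ)
    (hα : ∀ i, α i ≠ 0) (hβ : ∀ i, β i ≠ 0)
    (hD : (D.map (Nat.cast : ℕ → ℂ)).det ≠ 0)
    (hcol : ∀ i : Fin p, 2 ≤ (∑ l, C l i) + ∑ l, D l i)
    (hθa : AnalyticAt ℂ θ 0) (hθ0 : θ 0 = 0)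
    (hg₀a : AnalyticAt ℂ g₀ 0) (hg₀0 : g₀ 0 = 0)
    (hka : AnalyticAt ℂ k 0) (hk0 : k 0 = 0)
    (hf : ∀ u y w, f (u, y, w) =
      (fun i => α i * u i * (1 + θ (u, y, w) i),
       fun i => β i * (∏ l, u l ^ C l i) * (∏ l, y l ^ D l i) * (1 + g₀ (u, y, w) i),
       k (u, y, w)))
    (hcontr : ∀ c : ℂ,
      Module.End.HasEigenvalue (fderiv ℂ f 0).toLinearMap c → ‖c‖ < 1)
    (hdiag : ∃ (b : Module.Basis (Fin (r + p + t)) ℂ (Sp r p t)) (c : Fin (r + p + t) → ℂ),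
      ∀ i, fderiv ℂ f 0 (b i) = c i • b i)
    (lam : Fin s → ℂ) (hlam : ∀ i, lam i ≠ 0)
    (hchar : LinearMap.charpoly (fderiv ℂ f 0).toLinearMap
      = X ^ (r + p + t - s) * ∏ i, (X - Polynomial.C (lam i))) :
    ∃ (β' : Fin p → ℂ) (E : Matrix (Fin s) (Fin p) ℕ)
      (σp : Fin s → MvPolynomial (Fin s) ℂ) (gp : Fin p → MvPolynomial (Fin s) ℂ)
      (h : Sp s p (r + p + t - (s + p)) → Fin (r + p + t - (s + p)) → ℂ),
      (∀ i, β' i ≠ 0) ∧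
      -- σ is in Poincaré–Dulac normal form
      (∀ (kk : Fin s) (n : Fin s →₀ ℕ), MvPolynomial.coeff n (σp kk) ≠ 0 →
        n = Finsupp.single kk 1 ∨
          (2 ≤ (n.sum fun _ a => a) ∧ (∏ i, lam i ^ n i) = lam kk)) ∧
      (∀ kk : Fin s, MvPolynomial.coeff (Finsupp.single kk 1) (σp kk) = lam kk) ∧
      -- g contains only secondary resonant monomials and vanishes at 0
      (∀ i : Fin p, MvPolynomial.coeff 0 (gp i) = 0) ∧
      (∀ (i : Fin p) (n : Fin s →₀ ℕ), MvPolynomial.coeff n (gp i) ≠ 0 →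
        ((D.map (Nat.cast : ℕ → ℂ))
            - (∏ l, lam l ^ n l) • (1 : Matrix (Fin p) (Fin p) ℂ)).det = 0) ∧
      -- h is a holomorphic germ with dh₀ = 0
      AnalyticAt ℂ h 0 ∧ h 0 = 0 ∧ fderiv ℂ h 0 = 0 ∧
      -- the holomorphic conjugacy
      ∃ (Φ : Sp r p t → Sp s p (r + p + t - (s + p)))
        (L : Sp r p t ≃L[ℂ] Sp s p (r + p + t - (s + p))),
        AnalyticAt ℂ Φ 0 ∧ Φ 0 = 0 ∧
        HasFDerivAt Φ (L : Sp r p t →L[ℂ] Sp s p (r + p + t - (s + p))) 0 ∧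
        ∀ᶠ x in nhds (0 : Sp r p t), Φ (f x) =
          (fun w : Sp s p (r + p + t - (s + p)) =>
            ((fun kk => MvPolynomial.eval w.1 (σp kk)),
             (fun i => β' i * (∏ l, w.1 l ^ E l i) * (∏ l, w.2.1 l ^ D l i)
                 * (1 + MvPolynomial.eval w.1 (gp i))),
             h w)) (Φ x) := by
  classical
  obtain ⟨b, c, hbc⟩ := hdiag
  set A := fderiv ℂ f 0 with hA
  have hf' : f = fun x => (fun i => α i * x.1 i * (1 + θ x i),
       fun i => β i * (∏ l, x.1 l ^ C l i) * (∏ l, x.2.1 l ^ D l i) * (1 + g₀ x i), k x) :=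
    funext fun x => hf x.1 x.2.1 x.2.2
  let Pu (i : Fin r) : Sp r p t →L[ℂ] ℂ :=
    (ContinuousLinearMap.proj (R := ℂ) (φ := fun _ : Fin r => ℂ) i).comp
      (ContinuousLinearMap.fst ℂ _ _)
  let Py (i : Fin p) : Sp r p t →L[ℂ] ℂ :=
    (ContinuousLinearMap.proj (R := ℂ) (φ := fun _ : Fin p => ℂ) i).comp
      ((ContinuousLinearMap.fst ℂ _ _).comp (ContinuousLinearMap.snd ℂ (Fin r → ℂ) _))
  have hPu : ∀ i x, Pu i x = x.1 i := fun i x => rfl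
  have hPy : ∀ i x, Py i x = x.2.1 i := fun i x => rfl
  have hua : ∀ i, AnalyticAt ℂ (fun x : Sp r p t => x.1 i) 0 := fun i => (Pu i).analyticAt 0
  have hya : ∀ i, AnalyticAt ℂ (fun x : Sp r p t => x.2.1 i) 0 := fun i => (Py i).analyticAt 0
  have hθi : ∀ i, AnalyticAt ℂ (fun x => θ x i) 0 := fun i => analyticAt_pi_iff.1 hθa i
  have hgi : ∀ i, AnalyticAt ℂ (fun x => g₀ x i) 0 := fun i => analyticAt_pi_iff.1 hg₀a i
  have hfa : AnalyticAt ℂ f 0 := by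
    rw [hf']
    refine AnalyticAt.prod (AnalyticAt.pi fun i => ?_) (AnalyticAt.prod (AnalyticAt.pi fun i => ?_) hka)
    · exact (analyticAt_const.mul (hua i)).mul (analyticAt_const.add (hθi i))
    · refine ((analyticAt_const.mul ?_).mul ?_).mul (analyticAt_const.add (hgi i))
      · exact Finset.analyticAt_fun_prod _ fun l _ => (hua l).pow _
      · exact Finset.analyticAt_fun_prod _ fun l _ => (hya l).pow _
  have huO : ∀ i, (fun x : Sp r p t => x.1 i) =O[nhds 0] fun x => ‖x‖ ^ 1 := fun i =>
    analytic_isBigO_one (hua i) rfl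
  have hyO : ∀ i, (fun x : Sp r p t => x.2.1 i) =O[nhds 0] fun x => ‖x‖ ^ 1 := fun i =>
    analytic_isBigO_one (hya i) rfl
  have hG1 : ∀ i, (fun x => (f x).1 i - α i * x.1 i) =O[nhds 0] fun x => ‖x‖ ^ 2 := by
    intro i
    have h1 := ((huO i).mul (analytic_isBigO_one (hθi i) (by rw [hθ0]; rfl))).const_mul_left (α i)
    refine (h1.congr_left fun x => ?_).congr_right fun x => by ring
    rw [hf']; ring
  have hG2 : ∀ i, (fun x => (f x).2.1 i) =O[nhds 0] fun x => ‖x‖ ^ 2 := by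
    intro i
    have h1 := prod_pow_isBigO (fun l (x : Sp r p t) => x.1 l) huO (fun l => C l i)
    have h2 := prod_pow_isBigO (fun l (x : Sp r p t) => x.2.1 l) hyO (fun l => D l i)
    have h3 : (fun x => 1 + g₀ x i) =O[nhds 0] fun _ => (1 : ℝ) :=
      (analyticAt_const.add (hgi i)).continuousAt.isBigO_one ℝ
    have h4 := (((h1.mul h2).const_mul_left (β i)).mul h3)
    have h5 : (fun x : Sp r p t => ‖x‖ ^ (∑ l, C l i + ∑ l, D l i)) =O[nhds 0]
        fun x => ‖x‖ ^ 2 := isBigO_pow_le (hcol i)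
    refine Asymptotics.IsBigO.trans ((h4.congr_left fun x => ?_).congr_right fun x => ?_) h5
    · rw [hf']; ring
    · rw [pow_add, mul_one]
  have hf0 : f 0 = 0 := by
    refine Prod.ext ?_ (Prod.ext ?_ ?_)
    · ext i; rw [hf']; simp
    · ext i; exact isBigO_zero two_pos (hG2 i)
    · rw [hf']; exact hk0
  have hAf : HasFDerivAt f A 0 := hfa.differentiableAt.hasFDerivAt
  have hfu : ∀ i, HasFDerivAt (fun x => (f x).1 i) ((Pu i).comp A) 0 := fun i =>
    (Pu i).hasFDerivAt.comp 0 hAf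
  have hfy : ∀ i, HasFDerivAt (fun x => (f x).2.1 i) ((Py i).comp A) 0 := fun i =>
    (Py i).hasFDerivAt.comp 0 hAf
  have hAu : ∀ i x, Pu i (A x) = α i * Pu i x := by
    intro i x
    have h1 := (hfu i).sub ((Pu i).hasFDerivAt.const_mul (α i))
    have h2 := h1.unique (hasFDerivAt_zero_of_isBigO (hG1 i))
    have h3 := congrArg (fun T : Sp r p t →L[ℂ] ℂ => T x) h2
    exact sub_eq_zero.1 h3
  have hAy : ∀ i x, Py i (A x) = 0 := by
    intro i x
    have h2 := (hfy i).unique (hasFDerivAt_zero_of_isBigO (hG2 i))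
    exact congrArg (fun T : Sp r p t →L[ℂ] ℂ => T x) h2
  have hind : LinearIndependent ℂ (Sum.elim (fun i => ((Pu i : Sp r p t →ₗ[ℂ] ℂ) : Module.Dual ℂ (Sp r p t)))
      (fun i => ((Py i : Sp r p t →ₗ[ℂ] ℂ) : Module.Dual ℂ (Sp r p t)))) := by
    rw [Fintype.linearIndependent_iff]
    intro g hg
    have key : ∀ x : Sp r p t, ∑ i, g (Sum.inl i) * x.1 i + ∑ j, g (Sum.inr j) * x.2.1 j = 0 := by
      intro x
      have := congrArg (fun φ : Sp r p t →ₗ[ℂ] ℂ => φ x) hg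
      simp only [Fintype.sum_sum_type, Sum.elim_inl, Sum.elim_inr, LinearMap.add_apply,
        LinearMap.sum_apply, LinearMap.smul_apply, smul_eq_mul, LinearMap.zero_apply] at this
      exact this
    rintro (i | j)
    · have := key (Pi.single i 1, 0, 0)
      simpa [Pi.single_apply] using this
    · have := key (0, Pi.single j 1, 0)
      simpa [Pi.single_apply] using this
  have hdim : Module.finrank ℂ (Sp r p t) = r + p + t := by
    simp [Sp, Module.finrank_prod]; ring
  obtain ⟨v, e, hvu, hlamα, hvy, hvA, hv0⟩ := lin_alg hdim (A : Sp r p t →ₗ[ℂ] Sp r p t) _ _ hind α hα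
    hAu hAy b c hbc lam hlam hchar
  have hlam1 : ∀ i, ‖lam i‖ < 1 := by
    intro i
    refine hcontr _ ?_
    rw [Module.End.hasEigenvalue_iff_isRoot_charpoly, hchar, Polynomial.IsRoot.def,
      Polynomial.eval_mul, Polynomial.eval_prod]
    rw [Finset.prod_eq_zero (Finset.mem_univ i) (by simp), mul_zero]
  let T : Sp r p t ≃L[ℂ] ((Fin s ⊕ Fin p ⊕ Fin (r + p + t - (s + p))) → ℂ) := v.equivFunL
  have hT : ∀ x i, T x i = v.repr x i := fun x i => rfl
  let F (x : (Fin s ⊕ Fin p ⊕ Fin (r + p + t - (s + p))) → ℂ) := T (f (T.symm x))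
  let μ : (Fin s ⊕ Fin p ⊕ Fin (r + p + t - (s + p))) → ℂ := Sum.elim lam fun _ => 0
  have hTs : AnalyticAt ℂ (T.symm : _ → Sp r p t) 0 :=
    (T.symm : ((Fin s ⊕ Fin p ⊕ Fin (r + p + t - (s + p))) → ℂ) →L[ℂ] Sp r p t).analyticAt 0
  have hpull : ∀ {W : Type} [NormedAddCommGroup W] [NormedSpace ℂ W] {g : Sp r p t → W},
      AnalyticAt ℂ g 0 → AnalyticAt ℂ (fun x => g (T.symm x)) 0 := by
    intro W _ _ g hg
    rw [← map_zero T.symm] at hg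
    exact hg.comp hTs
  have hFa : AnalyticAt ℂ F 0 := by
    refine AnalyticAt.comp (g := T) ?_ (hpull hfa)
    exact T.analyticAt _
  have hF0 : F 0 = 0 := by simp [F, hf0]
  have hFd : HasFDerivAt F ((T : Sp r p t →L[ℂ] _).comp (A.comp (T.symm : _ →L[ℂ] Sp r p t))) 0 := by
    have h1 : HasFDerivAt f A (T.symm 0) := by rw [map_zero]; exact hAf
    exact T.hasFDerivAt.comp 0 (h1.comp 0 T.symm.hasFDerivAt)
  have hTA : ∀ x i, T (A (T.symm x)) i = μ i * x i := by
    intro x i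
    rcases i with i | i
    · rw [hT]
      refine (hvA i (T.symm x)).trans ?_
      rw [← hT, T.apply_symm_apply]; rfl
    · rw [hT]
      refine (hv0 i (T.symm x)).trans ?_
      simp [μ]
  have hgood : GoodGerm F μ := by
    refine ⟨hFa, fun i => ?_, ?_⟩
    · have hpa : AnalyticAt ℂ (fun x => F x i) 0 := analyticAt_pi_iff.1 hFa i
      refine analytic_isBigO_two (hpa.sub (analyticAt_const.mul (analytic_coord i))) (by simp [hF0]) ?_
      let Pi := ContinuousLinearMap.proj (R := ℂ)
        (φ := fun _ : (Fin s ⊕ Fin p ⊕ Fin (r + p + t - (s + p))) => ℂ) i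
      have h1 := (Pi.hasFDerivAt.comp 0 hFd).sub (Pi.hasFDerivAt.const_mul (μ i))
      refine h1.congr_fderiv ?_
      ext1 x
      exact sub_eq_zero.2 (hTA x i)
    · rintro (i | i)
      · exact hlam1 i
      · simp [μ]
  have hsu : ∀ x i, (T.symm x).1 i = x (Sum.inl (e i)) := by
    intro x i
    have := hvu i (T.symm x)
    rw [← hT, T.apply_symm_apply] at this
    exact this.symm
  have hsy : ∀ x i, (T.symm x).2.1 i = x (Sum.inr (Sum.inl i)) := by
    intro x i
    have := hvy i (T.symm x)
    rw [← hT, T.apply_symm_apply] at this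
    exact this.symm
  obtain ⟨E, σp, gp, hh, h1, h2, h3, h4, h5, h6, h7, Ψ, hΨa, hΨ0, hΨd, hΨF⟩ :=
    hgood.conclude (fun _ => rfl) hlam e β C D hD (fun i x => θ (T.symm x) i)
      (fun i => hpull (hθi i)) (fun i => by simp [hθ0]) (fun i x => g₀ (T.symm x) i)
      (fun i => hpull (hgi i)) (fun i => by simp [hg₀0])
      (fun i => Filter.Eventually.of_forall fun x => by
        refine (hvu i (f (T.symm x))).trans ?_
        change (f (T.symm x)).1 i = _
        rw [hf']
        simp only [hsu, μ, Sum.elim_inl, hlamα])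
      (fun j => Filter.Eventually.of_forall fun x => by
        refine (hvy j (f (T.symm x))).trans ?_
        change (f (T.symm x)).2.1 j = _
        rw [hf']
        simp only [hsu, hsy])
  refine ⟨β, E, σp, gp, hh, hβ, h1, h2, h3, h4, h5, h6, h7, fun x => Ψ (T x),
    T.trans (splitL s p (r + p + t - (s + p))), ?_, ?_, ?_, ?_⟩
  · rw [← map_zero T] at hΨa
    exact hΨa.comp (T.analyticAt 0)
  · simp only [map_zero, hΨ0]
  · rw [← map_zero T] at hΨd
    exact hΨd.comp 0 T.hasFDerivAt
  · have ht : Filter.Tendsto T (nhds 0) (nhds 0) := by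
      have := T.continuous.tendsto 0
      rwa [map_zero] at this
    filter_upwards [ht.eventually hΨF] with x hx
    rw [← hx]
    simp only [F, T.symm_apply_apply]

end
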